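/- arXiv:1610.09407 — 6 statements merged into one kernel-verified Lean document; each statement's English description precedes it below -/
import Mathlib

section
/- Let (U,V,W) be jointly distributed random variables with joint pmf p_{U,V,W} on finite sets 𝒰×𝒱×𝒲, let ε ∈ (0,1), n ∈ ℕ, and let N₁, N₂ be positive integers. Let W^n = (W₁,…,W_n) be i.i.d. according to p_W. Independently of W^n, generate two codebooks: U^n(1),…,U^n(N₁), each drawn i.i.d. according to p_U, and V^n(1),…,V^n(N₂), each drawn i.i.d. according to p_V, with all codewords mutually independent. Define the random set C = {(m,ℓ) ∈ [N₁]×[N₂] : (U^n(m), V^n(ℓ), W^n) ∈ T_ε^{(n)}(U,V,W)}. Then E[|C|] ≤ N₁·N₂·2^{−n(I(U;V) + I(U,V;W) − δ)}, where δ = ε·(H(U) + H(V) + H(U,V|W)). -/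
open MeasureTheory

/-- Shannon entropy (in bits) of a pmf on a finite alphabet. -/
noncomputable def pmfEnt {α : Type*} [Fintype α] (p : PMF α) : ℝ :=
  -∑ a : α, (p a).toReal * Real.logb 2 (p a).toReal

/-- The robustly typical set `T_ε^{(n)}` with respect to the pmf `p`:
all sequences whose empirical frequencies are within a relative `ε` of `p`. -/
def typSet {α : Type*} [DecidableEq α] (p : PMF α) (ε : ℝ) (n : ℕ) : Set (Fin n → α) :=
  {x | ∀ a : α,
    |((Finset.univ.filter fun i => x i = a).card : ℝ) / n - (p a).toReal| ≤ ε * (p a).toReal}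


section Typicality

variable {α : Type*} [DecidableEq α] {p : PMF α} {ε : ℝ} {n : ℕ} {x : Fin n → α}

lemma card_bounds_of_mem_typSet (hx : x ∈ typSet p ε n) (a : α) :
    n * ((1 - ε) * (p a).toReal) ≤ ((Finset.univ.filter fun i => x i = a).card : ℝ) ∧
      ((Finset.univ.filter fun i => x i = a).card : ℝ) ≤ n * ((1 + ε) * (p a).toReal) := by
  rcases Nat.eq_zero_or_pos n with rfl | hn
  · simp
  · have hn' : (0 : ℝ) < n := by exact_mod_cast hn
    obtain ⟨h₁, h₂⟩ := abs_le.1 (hx a)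
    rw [← le_div_iff₀' hn', ← div_le_iff₀' hn']
    constructor <;> linarith

lemma sum_comp_eq_sum_card_mul [Fintype α] (x : Fin n → α) (g : α → ℝ) :
    ∑ i, g (x i) = ∑ a, ((Finset.univ.filter fun i => x i = a).card : ℝ) * g a := by
  rw [← Finset.sum_fiberwise Finset.univ x]
  refine Finset.sum_congr rfl fun a _ => ?_
  rw [Finset.sum_congr rfl (g := fun _ => g a) fun i hi => by rw [(Finset.mem_filter.1 hi).2]]
  simp

lemma sum_le_of_mem_typSet [Fintype α] (hx : x ∈ typSet p ε n) {g : α → ℝ}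
    (hg : ∀ a, (p a).toReal ≠ 0 → 0 ≤ g a) :
    ∑ i, g (x i) ≤ n * ((1 + ε) * ∑ a, (p a).toReal * g a) := by
  rw [sum_comp_eq_sum_card_mul, Finset.mul_sum, Finset.mul_sum]
  refine Finset.sum_le_sum fun a _ => ?_
  obtain ⟨h₁, h₂⟩ := card_bounds_of_mem_typSet hx a
  by_cases ha : (p a).toReal = 0
  · rw [ha] at h₁ h₂ ⊢
    rw [le_antisymm (h₂.trans_eq (by ring : _ = (0 : ℝ))) (by positivity)]
    simp
  · calc _ ≤ n * ((1 + ε) * (p a).toReal) * g a := mul_le_mul_of_nonneg_right h₂ (hg a ha)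
      _ = _ := by ring

lemma le_sum_of_mem_typSet [Fintype α] (hx : x ∈ typSet p ε n) {g : α → ℝ} (hg : ∀ a, 0 ≤ g a) :
    n * ((1 - ε) * ∑ a, (p a).toReal * g a) ≤ ∑ i, g (x i) := by
  rw [sum_comp_eq_sum_card_mul, Finset.mul_sum, Finset.mul_sum]
  refine Finset.sum_le_sum fun a _ => ?_
  calc _ = n * ((1 - ε) * (p a).toReal) * g a := by ring
    _ ≤ _ := mul_le_mul_of_nonneg_right (card_bounds_of_mem_typSet hx a).1 (hg a)

lemma toReal_pos_of_mem_typSet (hx : x ∈ typSet p ε n) (i : Fin n) : 0 < (p (x i)).toReal := by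
  refine ENNReal.toReal_nonneg.lt_of_ne' fun h => ?_
  have h₂ := (card_bounds_of_mem_typSet hx (x i)).2
  rw [h, mul_zero, mul_zero] at h₂
  have : 0 < (Finset.univ.filter fun j => x j = x i).card :=
    Finset.card_pos.2 ⟨i, by simp⟩
  exact absurd h₂ (not_le.2 (by exact_mod_cast this))

end Typicality

namespace PMF

variable {α β : Type*}

lemma toReal_apply_le_one (p : PMF α) (a : α) : (p a).toReal ≤ 1 :=
  ENNReal.toReal_le_of_le_ofReal zero_le_one (by simpa using p.coe_le_one a)

lemma apply_le_map_apply (p : PMF α) (f : α → β) (a : α) : p a ≤ p.map f (f a) := by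
  classical
  rw [map_apply]
  exact le_trans (by simp) (ENNReal.le_tsum a)

lemma toReal_apply_le_map_apply (p : PMF α) (f : α → β) (a : α) :
    (p a).toReal ≤ (p.map f (f a)).toReal :=
  ENNReal.toReal_mono ((p.map f).apply_ne_top _) (p.apply_le_map_apply f a)

lemma map_apply_of_injective (p : PMF α) {f : α → β} (hf : f.Injective) (a : α) :
    p.map f (f a) = p a := by
  classical
  simp only [map_apply, hf.eq_iff]
  rw [tsum_eq_single a fun b hb => if_neg hb.symm, if_pos rfl]

lemma sum_toReal [Fintype α] (p : PMF α) : ∑ a, (p a).toReal = 1 := by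
  rw [← ENNReal.toReal_sum fun a _ => p.apply_ne_top a, ← tsum_fintype (L := .unconditional α),
    p.tsum_coe, ENNReal.toReal_one]

lemma sum_map_mul [Fintype α] [Fintype β] (p : PMF α) (f : α → β) (h : β → ℝ) :
    ∑ b, (p.map f b).toReal * h b = ∑ a, (p a).toReal * h (f a) := by
  classical
  have hb (b : β) : (p.map f b).toReal = ∑ a, if b = f a then (p a).toReal else 0 := by
    rw [map_apply, tsum_fintype, ENNReal.toReal_sum]
    · exact Finset.sum_congr rfl fun a _ => by split_ifs <;> simp
    · intro a _
      split_ifs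
      · exact p.apply_ne_top a
      · simp
  simp_rw [hb, Finset.sum_mul]
  rw [Finset.sum_comm]
  simp

lemma sum_mul_logb_map [Fintype α] [Fintype β] (p : PMF α) (f : α → β) :
    ∑ a, (p a).toReal * Real.logb 2 (p.map f (f a)).toReal = -pmfEnt (p.map f) := by
  rw [pmfEnt, neg_neg, p.sum_map_mul f fun b => Real.logb 2 (p.map f b).toReal]

lemma neg_logb_nonneg (p : PMF α) (a : α) : 0 ≤ -Real.logb 2 (p a).toReal :=
  neg_nonneg.2 (Real.logb_nonpos one_lt_two ENNReal.toReal_nonneg (p.toReal_apply_le_one a))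

end PMF

lemma prod_eq_two_rpow_sum_logb {ι : Type*} [Fintype ι] {f : ι → ℝ} (hf : ∀ i, 0 < f i) :
    ∏ i, f i = (2 : ℝ) ^ ∑ i, Real.logb 2 (f i) := by
  rw [Real.rpow_sum_of_pos two_pos]
  exact Finset.prod_congr rfl fun i _ => (Real.rpow_logb two_pos (by norm_num) (hf i)).symm

/-- On a jointly typical sequence, the product of the marginals exceeds the joint probability
by at most a factor governed by the mutual informations. -/
lemma prod_marginals_le_of_mem_typSet {𝒰 𝒱 𝒲 : Type*}
    [Fintype 𝒰] [Fintype 𝒱] [Fintype 𝒲]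
    [DecidableEq 𝒰] [DecidableEq 𝒱] [DecidableEq 𝒲]
    {p : PMF (𝒰 × 𝒱 × 𝒲)} {ε : ℝ} {n : ℕ} {x : Fin n → 𝒰 × 𝒱 × 𝒲} (hx : x ∈ typSet p ε n) :
    (∏ i, (p.map (fun t => t.1) (x i).1).toReal) * (∏ i, (p.map (fun t => t.2.1) (x i).2.1).toReal)
        * (∏ i, (p.map (fun t => t.2.2) (x i).2.2).toReal)
      ≤ (2 : ℝ) ^ (-(n : ℝ) *
        (((pmfEnt (p.map fun t => t.1) + pmfEnt (p.map fun t => t.2.1)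
            - pmfEnt (p.map fun t => (t.1, t.2.1)))
          + (pmfEnt (p.map fun t => (t.1, t.2.1)) + pmfEnt (p.map fun t => t.2.2)
            - pmfEnt (p.map fun t => ((t.1, t.2.1), t.2.2))))
         - ε * (pmfEnt (p.map fun t => t.1) + pmfEnt (p.map fun t => t.2.1)
            + (pmfEnt (p.map fun t => ((t.1, t.2.1), t.2.2))
              - pmfEnt (p.map fun t => t.2.2))))) * ∏ i, (p (x i)).toReal := by
  have hp := toReal_pos_of_mem_typSet hx
  have hU (i) := (hp i).trans_le (p.toReal_apply_le_map_apply (fun t => t.1) (x i))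
  have hV (i) := (hp i).trans_le (p.toReal_apply_le_map_apply (fun t => t.2.1) (x i))
  have hW (i) := (hp i).trans_le (p.toReal_apply_le_map_apply (fun t => t.2.2) (x i))
  rw [prod_eq_two_rpow_sum_logb hp, prod_eq_two_rpow_sum_logb hU, prod_eq_two_rpow_sum_logb hV,
    prod_eq_two_rpow_sum_logb hW, ← Real.rpow_add two_pos, ← Real.rpow_add two_pos,
    ← Real.rpow_add two_pos]
  refine Real.rpow_le_rpow_of_exponent_le one_le_two ?_
  have sU := le_sum_of_mem_typSet hx
    (g := fun t => -Real.logb 2 (p.map (fun t => t.1) t.1).toReal)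
    fun t => PMF.neg_logb_nonneg _ _
  have sV := le_sum_of_mem_typSet hx
    (g := fun t => -Real.logb 2 (p.map (fun t => t.2.1) t.2.1).toReal)
    fun t => PMF.neg_logb_nonneg _ _
  have sW := sum_le_of_mem_typSet hx
    (g := fun t => Real.logb 2 (p.map (fun t => t.2.2) t.2.2).toReal - Real.logb 2 (p t).toReal)
    fun t ht => sub_nonneg.2 <| Real.logb_le_logb_of_le one_lt_two
      (ENNReal.toReal_nonneg.lt_of_ne' ht) (p.toReal_apply_le_map_apply (fun t => t.2.2) t)
  have eUVW : ∑ t, (p t).toReal * Real.logb 2 (p t).toReal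
      = -pmfEnt (p.map fun t => ((t.1, t.2.1), t.2.2)) := by
    rw [← p.sum_mul_logb_map]
    refine Finset.sum_congr rfl fun t _ => ?_
    rw [p.map_apply_of_injective (f := fun t => ((t.1, t.2.1), t.2.2))
      fun a b h => by simpa [Prod.ext_iff, and_assoc] using h]
  simp only [mul_neg, mul_sub, Finset.sum_neg_distrib, Finset.sum_sub_distrib,
    p.sum_mul_logb_map (fun t => t.1), p.sum_mul_logb_map (fun t => t.2.1),
    p.sum_mul_logb_map (fun t => t.2.2), eUVW] at sU sV sW
  linarith

section Codebook

variable {𝒰 𝒱 𝒲 : Type*}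

/-- The joint law of two independent i.i.d. codebooks and an independent i.i.d. sequence. -/
noncomputable def codebookMeasure [MeasurableSpace 𝒰] [MeasurableSpace 𝒱] [MeasurableSpace 𝒲]
    (qU : PMF 𝒰) (qV : PMF 𝒱) (qW : PMF 𝒲) (n N₁ N₂ : ℕ) :
    Measure ((Fin N₁ → Fin n → 𝒰) × (Fin N₂ → Fin n → 𝒱) × (Fin n → 𝒲)) :=
  (Measure.pi fun _ : Fin N₁ => Measure.pi fun _ : Fin n => qU.toMeasure).prod
    ((Measure.pi fun _ : Fin N₂ => Measure.pi fun _ : Fin n => qV.toMeasure).prod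
      (Measure.pi fun _ : Fin n => qW.toMeasure))

instance [MeasurableSpace 𝒰] [MeasurableSpace 𝒱] [MeasurableSpace 𝒲]
    (qU : PMF 𝒰) (qV : PMF 𝒱) (qW : PMF 𝒲) (n N₁ N₂ : ℕ) :
    IsProbabilityMeasure (codebookMeasure qU qV qW n N₁ N₂) := by
  unfold codebookMeasure
  infer_instance

lemma PMF.pi_toMeasure_map {ι α β : Type*} [Fintype ι] [MeasurableSpace α] [MeasurableSpace β]
    {φ : α → β} (hφ : Measurable φ) (q : PMF α) :
    (Measure.pi fun _ : ι => (q.map φ).toMeasure)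
      = (Measure.pi fun _ : ι => q.toMeasure).map fun x i => φ (x i) := by
  have : SigmaFinite (q.toMeasure.map φ) := by
    rw [PMF.toMeasure_map φ q hφ]
    infer_instance
  simp_rw [← PMF.toMeasure_map φ q hφ]
  exact (Measure.pi_map_pi fun _ => hφ.aemeasurable).symm

lemma PMF.pi_pi_toMeasure_map {ι κ α β : Type*} [Fintype ι] [Fintype κ] [MeasurableSpace α]
    [MeasurableSpace β] {φ : α → β} (hφ : Measurable φ) (q : PMF α) :
    (Measure.pi fun _ : ι => Measure.pi fun _ : κ => (q.map φ).toMeasure)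
      = (Measure.pi fun _ : ι => Measure.pi fun _ : κ => q.toMeasure).map
          fun x i j => φ (x i j) := by
  have hφ' : Measurable fun (y : κ → α) j => φ (y j) := by fun_prop
  have : IsProbabilityMeasure
      ((Measure.pi fun _ : κ => q.toMeasure).map fun (y : κ → α) j => φ (y j)) :=
    Measure.isProbabilityMeasure_map hφ'.aemeasurable
  simp_rw [PMF.pi_toMeasure_map hφ q]
  exact (Measure.pi_map_pi fun _ => hφ'.aemeasurable).symm

lemma measurePreserving_codebookMeasure {𝒰' 𝒱' 𝒲' : Type*}
    [MeasurableSpace 𝒰] [MeasurableSpace 𝒱] [MeasurableSpace 𝒲]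
    [MeasurableSpace 𝒰'] [MeasurableSpace 𝒱'] [MeasurableSpace 𝒲']
    {φ : 𝒰 → 𝒰'} {ψ : 𝒱 → 𝒱'} {χ : 𝒲 → 𝒲'}
    (hφ : Measurable φ) (hψ : Measurable ψ) (hχ : Measurable χ)
    (qU : PMF 𝒰) (qV : PMF 𝒱) (qW : PMF 𝒲) (n N₁ N₂ : ℕ) :
    MeasurePreserving
      (Prod.map (fun x i j => φ (x i j)) (Prod.map (fun y i j => ψ (y i j)) fun z j => χ (z j)))
      (codebookMeasure qU qV qW n N₁ N₂)
      (codebookMeasure (qU.map φ) (qV.map ψ) (qW.map χ) n N₁ N₂) where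
  measurable := by fun_prop
  map_eq := by
    unfold codebookMeasure
    rw [PMF.pi_pi_toMeasure_map hφ, PMF.pi_pi_toMeasure_map hψ, PMF.pi_toMeasure_map hχ,
      Measure.map_prod_map _ _ (by fun_prop) (by fun_prop),
      Measure.map_prod_map _ _ (by fun_prop) (by fun_prop)]

lemma integral_codebookMeasure_map {𝒰' 𝒱' 𝒲' : Type*}
    [MeasurableSpace 𝒰] [MeasurableSpace 𝒱] [MeasurableSpace 𝒲]
    [MeasurableSpace 𝒰'] [MeasurableSpace 𝒱'] [MeasurableSpace 𝒲']
    {φ : 𝒰 → 𝒰'} {ψ : 𝒱 → 𝒱'} {χ : 𝒲 → 𝒲'}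
    (hφ : Measurable φ) (hψ : Measurable ψ) (hχ : Measurable χ)
    (qU : PMF 𝒰) (qV : PMF 𝒱) (qW : PMF 𝒲) (n N₁ N₂ : ℕ)
    {F : (Fin N₁ → Fin n → 𝒰') × (Fin N₂ → Fin n → 𝒱') × (Fin n → 𝒲') → ℝ}
    (hF : AEStronglyMeasurable F (codebookMeasure (qU.map φ) (qV.map ψ) (qW.map χ) n N₁ N₂)) :
    ∫ x, F x ∂codebookMeasure (qU.map φ) (qV.map ψ) (qW.map χ) n N₁ N₂
      = ∫ x, F (fun i j => φ (x.1 i j), fun i j => ψ (x.2.1 i j), fun j => χ (x.2.2 j))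
          ∂codebookMeasure qU qV qW n N₁ N₂ := by
  have h := measurePreserving_codebookMeasure hφ hψ hχ qU qV qW n N₁ N₂
  rw [← h.map_eq, integral_map h.aemeasurable (h.map_eq.symm ▸ hF)]
  rfl

lemma integral_codebookMeasure_sum [Finite 𝒰] [Finite 𝒱] [Finite 𝒲]
    [MeasurableSpace 𝒰] [MeasurableSpace 𝒱] [MeasurableSpace 𝒲]
    [MeasurableSingletonClass 𝒰] [MeasurableSingletonClass 𝒱] [MeasurableSingletonClass 𝒲]
    (qU : PMF 𝒰) (qV : PMF 𝒱) (qW : PMF 𝒲) (n N₁ N₂ : ℕ)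
    (F : (Fin n → 𝒰) × (Fin n → 𝒱) × (Fin n → 𝒲) → ℝ) :
    ∫ x, (∑ m : Fin N₁, ∑ l : Fin N₂, F (x.1 m, x.2.1 l, x.2.2))
        ∂codebookMeasure qU qV qW n N₁ N₂
      = N₁ * N₂ * ∫ y, F y ∂((Measure.pi fun _ => qU.toMeasure).prod
          ((Measure.pi fun _ => qV.toMeasure).prod (Measure.pi fun _ => qW.toMeasure))) := by
  rw [integral_finsetSum _ fun _ _ => Integrable.of_finite]
  simp_rw [integral_finsetSum _ fun _ _ => Integrable.of_finite]
  have h (m : Fin N₁) (l : Fin N₂) : MeasurePreserving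
      (fun x : (Fin N₁ → Fin n → 𝒰) × (Fin N₂ → Fin n → 𝒱) × (Fin n → 𝒲) =>
        (x.1 m, x.2.1 l, x.2.2)) (codebookMeasure qU qV qW n N₁ N₂)
      ((Measure.pi fun _ => qU.toMeasure).prod
          ((Measure.pi fun _ => qV.toMeasure).prod (Measure.pi fun _ => qW.toMeasure))) :=
    (measurePreserving_eval _ m).prod ((measurePreserving_eval _ l).prod (.id _))
  have hF (m : Fin N₁) (l : Fin N₂) := integral_map (h m l).aemeasurable
    (f := F) AEStronglyMeasurable.of_discrete
  simp_rw [← hF, (h _ _).map_eq]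
  simp [mul_assoc]

lemma integral_pi_toMeasure_prod [Fintype 𝒰] [Fintype 𝒱] [Fintype 𝒲]
    [MeasurableSpace 𝒰] [MeasurableSpace 𝒱] [MeasurableSpace 𝒲]
    [MeasurableSingletonClass 𝒰] [MeasurableSingletonClass 𝒱] [MeasurableSingletonClass 𝒲]
    (qU : PMF 𝒰) (qV : PMF 𝒱) (qW : PMF 𝒲) (n : ℕ) (G : (Fin n → 𝒰 × 𝒱 × 𝒲) → ℝ) :
    ∫ y, G (fun i => (y.1 i, y.2.1 i, y.2.2 i)) ∂((Measure.pi fun _ => qU.toMeasure).prod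
          ((Measure.pi fun _ => qV.toMeasure).prod (Measure.pi fun _ => qW.toMeasure)))
      = ∑ x : Fin n → 𝒰 × 𝒱 × 𝒲, (∏ i, (qU (x i).1).toReal) * (∏ i, (qV (x i).2.1).toReal)
          * (∏ i, (qW (x i).2.2).toReal) * G x := by
  classical
  rw [integral_fintype Integrable.of_finite]
  let e : (Fin n → 𝒰) × (Fin n → 𝒱) × (Fin n → 𝒲) ≃ (Fin n → 𝒰 × 𝒱 × 𝒲) :=
    { toFun y i := (y.1 i, y.2.1 i, y.2.2 i)
      invFun x := (fun i => (x i).1, fun i => (x i).2.1, fun i => (x i).2.2) }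
  refine Fintype.sum_equiv e _ _ fun y => ?_
  obtain ⟨a, b, c⟩ := y
  have hs : ({(a, b, c)} : Set ((Fin n → 𝒰) × (Fin n → 𝒱) × (Fin n → 𝒲))) =
      {a} ×ˢ {b} ×ˢ {c} := by simp
  rw [hs, measureReal_prod_prod, measureReal_prod_prod]
  simp [Measure.real, e, ENNReal.toReal_prod, mul_assoc,
    PMF.toMeasure_apply_singleton _ _ (measurableSet_singleton _)]

end Codebook

lemma integral_typical_pairs_le {𝒰 𝒱 𝒲 : Type*}
    [Fintype 𝒰] [Fintype 𝒱] [Fintype 𝒲]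
    [DecidableEq 𝒰] [DecidableEq 𝒱] [DecidableEq 𝒲]
    [MeasurableSpace 𝒰] [MeasurableSpace 𝒱] [MeasurableSpace 𝒲]
    [MeasurableSingletonClass 𝒰] [MeasurableSingletonClass 𝒱] [MeasurableSingletonClass 𝒲]
    (p : PMF (𝒰 × 𝒱 × 𝒲)) (ε : ℝ) (n N₁ N₂ : ℕ) :
    (∫ x, (∑ m : Fin N₁, ∑ l : Fin N₂,
          (typSet p ε n).indicator (fun _ => (1 : ℝ)) (fun i => (x.1 m i, x.2.1 l i, x.2.2 i)))
      ∂codebookMeasure (p.map fun t => t.1) (p.map fun t => t.2.1) (p.map fun t => t.2.2) n N₁ N₂)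
    ≤ (N₁ : ℝ) * (N₂ : ℝ) *
      (2 : ℝ) ^ (-(n : ℝ) *
        (((pmfEnt (p.map fun t => t.1) + pmfEnt (p.map fun t => t.2.1)
            - pmfEnt (p.map fun t => (t.1, t.2.1)))
          + (pmfEnt (p.map fun t => (t.1, t.2.1)) + pmfEnt (p.map fun t => t.2.2)
            - pmfEnt (p.map fun t => ((t.1, t.2.1), t.2.2))))
         - ε * (pmfEnt (p.map fun t => t.1) + pmfEnt (p.map fun t => t.2.1)
            + (pmfEnt (p.map fun t => ((t.1, t.2.1), t.2.2))
              - pmfEnt (p.map fun t => t.2.2))))) := by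
  rw [integral_codebookMeasure_sum _ _ _ n N₁ N₂ fun y =>
      (typSet p ε n).indicator (fun _ => (1 : ℝ)) fun i => (y.1 i, y.2.1 i, y.2.2 i),
    integral_pi_toMeasure_prod _ _ _ n ((typSet p ε n).indicator fun _ => 1)]
  refine mul_le_mul_of_nonneg_left ?_ (by positivity)
  have h1 : ∑ x : Fin n → 𝒰 × 𝒱 × 𝒲, ∏ i, (p (x i)).toReal = 1 := by
    rw [← Fintype.prod_sum fun (_ : Fin n) t => (p t).toReal]
    simp [p.sum_toReal]
  rw [← mul_one ((2 : ℝ) ^ _)]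
  conv_rhs => rw [← h1, Finset.mul_sum]
  refine Finset.sum_le_sum fun x _ => ?_
  by_cases hx : x ∈ typSet p ε n
  · rw [Set.indicator_of_mem hx, mul_one]
    exact prod_marginals_le_of_mem_typSet hx
  · simp only [hx, not_false_eq_true, Set.indicator_of_notMem, mul_zero]
    exact mul_nonneg (by positivity) (Finset.prod_nonneg fun _ _ => ENNReal.toReal_nonneg)

/-- Expected size of the set of jointly typical codeword pairs, for two independently
generated codebooks and an independent i.i.d. sequence `W^n`:
`E[|C|] ≤ N₁·N₂·2^{−n(I(U;V) + I(U,V;W) − δ)}` with `δ = ε(H(U) + H(V) + H(U,V|W))`.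
The ambient measure is the product of the `N₁` i.i.d.-`p_U` codewords, the `N₂`
i.i.d.-`p_V` codewords, and the i.i.d.-`p_W` sequence; `|C|` is the number of index pairs
`(m, ℓ)` such that `(U^n(m), V^n(ℓ), W^n)` is jointly typical. -/
theorem stmt_0 {𝒰 𝒱 𝒲 : Type*}
    [Fintype 𝒰] [Fintype 𝒱] [Fintype 𝒲]
    [DecidableEq 𝒰] [DecidableEq 𝒱] [DecidableEq 𝒲]
    [MeasurableSpace 𝒰] [MeasurableSpace 𝒱] [MeasurableSpace 𝒲]
    (p : PMF (𝒰 × 𝒱 × 𝒲)) (ε : ℝ) (hε : ε ∈ Set.Ioo (0 : ℝ) 1)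
    (n N₁ N₂ : ℕ) (hN₁ : 0 < N₁) (hN₂ : 0 < N₂) :
    (∫ x : (Fin N₁ → Fin n → 𝒰) × (Fin N₂ → Fin n → 𝒱) × (Fin n → 𝒲),
        (∑ m : Fin N₁, ∑ l : Fin N₂,
          (typSet p ε n).indicator (fun _ => (1 : ℝ)) (fun i => (x.1 m i, x.2.1 l i, x.2.2 i)))
      ∂ ((Measure.pi fun _ : Fin N₁ => Measure.pi fun _ : Fin n =>
            (p.map fun t => t.1).toMeasure).prod
         ((Measure.pi fun _ : Fin N₂ => Measure.pi fun _ : Fin n =>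
            (p.map fun t => t.2.1).toMeasure).prod
          (Measure.pi fun _ : Fin n => (p.map fun t => t.2.2).toMeasure))))
    ≤ (N₁ : ℝ) * (N₂ : ℝ) *
      (2 : ℝ) ^ (-(n : ℝ) *
        (((pmfEnt (p.map fun t => t.1) + pmfEnt (p.map fun t => t.2.1)
            - pmfEnt (p.map fun t => (t.1, t.2.1)))
          + (pmfEnt (p.map fun t => (t.1, t.2.1)) + pmfEnt (p.map fun t => t.2.2)
            - pmfEnt (p.map fun t => ((t.1, t.2.1), t.2.2))))
         - ε * (pmfEnt (p.map fun t => t.1) + pmfEnt (p.map fun t => t.2.1)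
            + (pmfEnt (p.map fun t => ((t.1, t.2.1), t.2.2))
              - pmfEnt (p.map fun t => t.2.2))))) := by
  by_cases hF : AEStronglyMeasurable
      (fun x : (Fin N₁ → Fin n → 𝒰) × (Fin N₂ → Fin n → 𝒱) × (Fin n → 𝒲) =>
        ∑ m : Fin N₁, ∑ l : Fin N₂,
          (typSet p ε n).indicator (fun _ => (1 : ℝ)) (fun i => (x.1 m i, x.2.1 l i, x.2.2 i)))
      (codebookMeasure (p.map fun t => t.1) (p.map fun t => t.2.1) (p.map fun t => t.2.2) n N₁ N₂)
  · -- Refining the σ-algebras to the discrete ones does not change the integral.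
    have h := @integral_codebookMeasure_map 𝒰 𝒱 𝒲 𝒰 𝒱 𝒲 ⊤ ⊤ ⊤ _ _ _ id id id
      (measurable_id'' le_top) (measurable_id'' le_top) (measurable_id'' le_top)
      (p.map fun t => t.1) (p.map fun t => t.2.1) (p.map fun t => t.2.2) n N₁ N₂
    simp only [PMF.map_id] at h
    rw [← codebookMeasure, h hF]
    exact @integral_typical_pairs_le 𝒰 𝒱 𝒲 _ _ _ _ _ _ ⊤ ⊤ ⊤
      (@MeasurableSingletonClass.mk _ ⊤ fun _ => trivial)
      (@MeasurableSingletonClass.mk _ ⊤ fun _ => trivial)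
      (@MeasurableSingletonClass.mk _ ⊤ fun _ => trivial) p ε n N₁ N₂
  · rw [← codebookMeasure, integral_non_aestronglyMeasurable hF]
    positivity
end

section
/- Expected count of bin-pairs with a prescribed agreement pattern under independent random binning. Let N_{u0}, N_{u1}, N_{u2}, N_{v0}, N_{v1}, N_{v2}, M₁, M₂ be positive integers. Assign to each triple (k₀,k₁,k₂) ∈ [N_{u0}]×[N_{u1}]×[N_{u2}] an index m₁(k₀,k₁,k₂) drawn uniformly from [M₁], and to each triple (ℓ₀,ℓ₁,ℓ₂) ∈ [N_{v0}]×[N_{v1}]×[N_{v2}] an index m₂(ℓ₀,ℓ₁,ℓ₂) drawn uniformly from [M₂], all assignments mutually independent. Let B₁ = {(k₀,k₁,k₂) : m₁(k₀,k₁,k₂) = 1} and B₂ = {(ℓ₀,ℓ₁,ℓ₂) : m₂(ℓ₀,ℓ₁,ℓ₂) = 1}. Fix a pattern (a₀,a₁,a₂,b₀,b₁,b₂) ∈ {1,2}⁶ and let Q be the number of quadruples of triples ((k₀,k₁,k₂),(ℓ₀,ℓ₁,ℓ₂),(k'₀,k'₁,k'₂),(ℓ'₀,ℓ'₁,ℓ'₂))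 such that (k₀,k₁,k₂) ∈ B₁, (k'₀,k'₁,k'₂) ∈ B₁, (ℓ₀,ℓ₁,ℓ₂) ∈ B₂, (ℓ'₀,ℓ'₁,ℓ'₂) ∈ B₂, and for each j ∈ {0,1,2}: k_j = k'_j if and only if a_j = 1, and ℓ_j = ℓ'_j if and only if b_j = 1. Then E[Q] ≤ (∏_{j=0}^{2} N_{uj}^{a_j}) · (∏_{j=0}^{2} N_{vj}^{b_j}) · M₁^{−(1 + 1{∃j: a_j = 2})} · M₂^{−(1 + 1{∃j: b_j = 2})}. -/
open MeasureTheory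
open scoped ENNReal

/-- The uniform probability measure on `Fin M` (for `M ≥ 1`): counting measure normalized
by `M`. -/
noncomputable def unifM (M : ℕ) : Measure (Fin M) := ((M : ℝ≥0∞))⁻¹ • Measure.count

lemma unifM_singleton {M : ℕ} (v : Fin M) : unifM M {v} = (M : ℝ≥0∞)⁻¹ := by
  simp [unifM]

lemma unifM_isProbabilityMeasure {M : ℕ} (hM : 0 < M) : IsProbabilityMeasure (unifM M) := by
  constructor
  have h : Measure.count (Set.univ : Set (Fin M)) = M := by
    rw [Measure.count_apply MeasurableSet.univ]
    simp
  rw [unifM, Measure.smul_apply, h, smul_eq_mul]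
  exact ENNReal.inv_mul_cancel (by simpa using hM.ne') (by simp)

/-- Two independent uniform labels both take a given value with probability `M⁻¹` or `M⁻²`,
according to whether they are the same label. -/
lemma pi_unifM_real_eq_and_eq {K : Type*} [Fintype K] [DecidableEq K] {M : ℕ} (hM : 0 < M)
    (v : Fin M) (k k' : K) :
    (Measure.pi fun _ : K => unifM M).real {x | x k = v ∧ x k' = v} =
      ((M : ℝ)⁻¹) ^ ({k, k'} : Finset K).card := by
  have := unifM_isProbabilityMeasure hM
  have hset : {x : K → Fin M | x k = v ∧ x k' = v} =
      Set.univ.pi fun i => if i ∈ ({k, k'} : Finset K) then {v} else Set.univ := by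
    ext x
    simp only [Set.mem_ofPred_eq, Set.mem_pi, Set.mem_univ, true_implies]
    constructor
    · rintro ⟨h, h'⟩ i
      split_ifs with hi
      · rcases Finset.mem_insert.1 hi with rfl | hi
        · exact h
        · rw [Finset.mem_singleton.1 hi]; exact h'
      · trivial
    · intro h
      exact ⟨by simpa using h k, by simpa using h k'⟩
  have hfac (i : K) : unifM M (if i ∈ ({k, k'} : Finset K) then {v} else Set.univ) =
      if i ∈ ({k, k'} : Finset K) then (M : ℝ≥0∞)⁻¹ else 1 := by
    split_ifs
    · exact unifM_singleton v
    · exact measure_univ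
  rw [measureReal_def, hset, Measure.pi_pi, Finset.prod_congr rfl fun i _ => hfac i,
    Finset.prod_ite_mem, Finset.univ_inter, Finset.prod_const]
  simp

/-- The expected number of pairs in a finite set `S` whose two labels both equal `v`. -/
lemma integral_card_filter_pairs {K : Type*} [Fintype K] [DecidableEq K] {M : ℕ} (hM : 0 < M)
    (v : Fin M) (S : Finset (K × K)) :
    ∫ x : K → Fin M, ((S.filter fun p => x p.1 = v ∧ x p.2 = v).card : ℝ)
      ∂(Measure.pi fun _ : K => unifM M) =
      ∑ p ∈ S, ((M : ℝ)⁻¹) ^ ({p.1, p.2} : Finset K).card := by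
  have := unifM_isProbabilityMeasure hM
  have hcard (x : K → Fin M) : ((S.filter fun p => x p.1 = v ∧ x p.2 = v).card : ℝ) =
      ∑ p ∈ S, {x : K → Fin M | x p.1 = v ∧ x p.2 = v}.indicator (1 : (K → Fin M) → ℝ) x := by
    rw [Finset.card_filter]
    push_cast
    simp [Set.indicator_apply]
  simp_rw [hcard]
  rw [integral_finsetSum _ fun p _ => Integrable.of_finite]
  refine Finset.sum_congr rfl fun p _ => ?_
  rw [integral_indicator_one (Set.toFinite _).measurableSet, pi_unifM_real_eq_and_eq hM]

lemma card_filter_eq_iff_le (n : ℕ) {c : ℕ} (hc : c = 1 ∨ c = 2) :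
    (Finset.univ.filter fun p : Fin n × Fin n => p.1 = p.2 ↔ c = 1).card ≤ n ^ c := by
  rcases hc with rfl | rfl
  · refine (Finset.card_le_card_of_injOn Prod.fst (t := Finset.univ) (by simp) ?_).trans (by simp)
    rintro ⟨i, j⟩ hi ⟨i', j'⟩ hi' h
    simp_all
  · exact (Finset.card_le_univ _).trans (by simp [sq])

/-- Pairs of triples whose coordinates of index `j` agree exactly when `a j = 1`. -/
def agreementPairs (N a : Fin 3 → ℕ) :
    Finset ((Fin (N 0) × Fin (N 1) × Fin (N 2)) × (Fin (N 0) × Fin (N 1) × Fin (N 2))) :=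
  Finset.univ.filter fun p => (p.1.1 = p.2.1 ↔ a 0 = 1) ∧ (p.1.2.1 = p.2.2.1 ↔ a 1 = 1) ∧
    (p.1.2.2 = p.2.2.2 ↔ a 2 = 1)

lemma card_agreementPairs_le (N a : Fin 3 → ℕ) (ha : ∀ j, a j = 1 ∨ a j = 2) :
    (agreementPairs N a).card ≤ ∏ j, N j ^ a j := by
  let D (j : Fin 3) := Finset.univ.filter fun p : Fin (N j) × Fin (N j) => p.1 = p.2 ↔ a j = 1
  calc (agreementPairs N a).card ≤ (D 0 ×ˢ D 1 ×ˢ D 2).card := by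
        refine Finset.card_le_card_of_injOn
          (fun p => ((p.1.1, p.2.1), (p.1.2.1, p.2.2.1), (p.1.2.2, p.2.2.2))) ?_ ?_
        · intro p hp
          simpa [agreementPairs, D] using hp
        · rintro ⟨⟨_, _, _⟩, ⟨_, _, _⟩⟩ _ ⟨⟨_, _, _⟩, ⟨_, _, _⟩⟩ _ h
          simp_all
    _ ≤ ∏ j, N j ^ a j := by
        rw [Finset.card_product, Finset.card_product, Fin.prod_univ_three, mul_assoc]
        gcongr <;> exact card_filter_eq_iff_le _ (ha _)

lemma card_pair_of_mem_agreementPairs {N a : Fin 3 → ℕ} (ha : ∀ j, a j = 1 ∨ a j = 2)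
    {p : (Fin (N 0) × Fin (N 1) × Fin (N 2)) × (Fin (N 0) × Fin (N 1) × Fin (N 2))}
    (hp : p ∈ agreementPairs N a) :
    ({p.1, p.2} : Finset _).card = 1 + if ∃ j, a j = 2 then 1 else 0 := by
  obtain ⟨⟨k₀, k₁, k₂⟩, ⟨l₀, l₁, l₂⟩⟩ := p
  simp only [agreementPairs, Finset.mem_filter, Finset.mem_univ, true_and] at hp
  obtain ⟨h0, h1, h2⟩ := hp
  split_ifs with h
  · refine Finset.card_pair fun heq => ?_
    simp only [Prod.mk.injEq] at heq
    obtain ⟨j, hj⟩ := h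
    fin_cases j <;> simp_all
  · have hone (j : Fin 3) : a j = 1 := (ha j).resolve_right fun hj => h ⟨j, hj⟩
    rw [h0.2 (hone 0), h1.2 (hone 1), h2.2 (hone 2)]
    simp

lemma integral_card_agreementPairs_le (N a : Fin 3 → ℕ) (ha : ∀ j, a j = 1 ∨ a j = 2)
    {M : ℕ} (hM : 0 < M) (v : Fin M) :
    ∫ x : (Fin (N 0) × Fin (N 1) × Fin (N 2)) → Fin M,
        (((agreementPairs N a).filter fun p => x p.1 = v ∧ x p.2 = v).card : ℝ)
      ∂(Measure.pi fun _ : Fin (N 0) × Fin (N 1) × Fin (N 2) => unifM M) ≤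
      (∏ j, (N j : ℝ) ^ a j) * (M : ℝ) ^ (-(1 + (if ∃ j, a j = 2 then 1 else 0)) : ℤ) := by
  have hexp : (M : ℝ) ^ (-(1 + (if ∃ j, a j = 2 then 1 else 0)) : ℤ) =
      ((M : ℝ)⁻¹) ^ (1 + if ∃ j, a j = 2 then 1 else 0) := by
    rw [zpow_neg, inv_pow, ← zpow_natCast]
    push_cast
    rfl
  rw [integral_card_filter_pairs hM, hexp,
    Finset.sum_congr rfl fun p hp => by rw [card_pair_of_mem_agreementPairs ha hp],
    Finset.sum_const, nsmul_eq_mul]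
  gcongr
  exact_mod_cast card_agreementPairs_le N a ha

/-- Expected count of bin-pairs with a prescribed agreement pattern under independent random
binning. The triples `(k₀,k₁,k₂)` and `(ℓ₀,ℓ₁,ℓ₂)` are binned independently and uniformly into
`[M₁]` and `[M₂]` respectively; `B₁, B₂` are the bins of index `1`; `Q` counts quadruples
`(k, ℓ, k', ℓ')` with `k, k' ∈ B₁`, `ℓ, ℓ' ∈ B₂` and, for each `j`, `k_j = k'_j ↔ a_j = 1`
and `ℓ_j = ℓ'_j ↔ b_j = 1`.  Then
`E[Q] ≤ (∏ N_{uj}^{a_j})(∏ N_{vj}^{b_j}) · M₁^{−(1+1{∃j: a_j=2})} · M₂^{−(1+1{∃j: b_j=2})}`. -/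
theorem stmt_2 (Nu Nv : Fin 3 → ℕ) (M₁ M₂ : ℕ)
    (hNu : ∀ j, 0 < Nu j) (hNv : ∀ j, 0 < Nv j) (hM₁ : 0 < M₁) (hM₂ : 0 < M₂)
    (a b : Fin 3 → ℕ) (ha : ∀ j, a j = 1 ∨ a j = 2) (hb : ∀ j, b j = 1 ∨ b j = 2) :
    (∫ x : ((Fin (Nu 0) × Fin (Nu 1) × Fin (Nu 2)) → Fin M₁) ×
           ((Fin (Nv 0) × Fin (Nv 1) × Fin (Nv 2)) → Fin M₂),
      ((Finset.univ.filter
        (fun q : (Fin (Nu 0) × Fin (Nu 1) × Fin (Nu 2)) ×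
                 (Fin (Nv 0) × Fin (Nv 1) × Fin (Nv 2)) ×
                 (Fin (Nu 0) × Fin (Nu 1) × Fin (Nu 2)) ×
                 (Fin (Nv 0) × Fin (Nv 1) × Fin (Nv 2)) =>
          x.1 q.1 = ⟨0, hM₁⟩ ∧ x.1 q.2.2.1 = ⟨0, hM₁⟩ ∧
          x.2 q.2.1 = ⟨0, hM₂⟩ ∧ x.2 q.2.2.2 = ⟨0, hM₂⟩ ∧
          (q.1.1 = q.2.2.1.1 ↔ a 0 = 1) ∧
          (q.1.2.1 = q.2.2.1.2.1 ↔ a 1 = 1) ∧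
          (q.1.2.2 = q.2.2.1.2.2 ↔ a 2 = 1) ∧
          (q.2.1.1 = q.2.2.2.1 ↔ b 0 = 1) ∧
          (q.2.1.2.1 = q.2.2.2.2.1 ↔ b 1 = 1) ∧
          (q.2.1.2.2 = q.2.2.2.2.2 ↔ b 2 = 1))).card : ℝ)
      ∂ ((Measure.pi fun _ : (Fin (Nu 0) × Fin (Nu 1) × Fin (Nu 2)) => unifM M₁).prod
         (Measure.pi fun _ : (Fin (Nv 0) × Fin (Nv 1) × Fin (Nv 2)) => unifM M₂)))
    ≤ (∏ j : Fin 3, (Nu j : ℝ) ^ (a j)) * (∏ j : Fin 3, (Nv j : ℝ) ^ (b j)) *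
      (M₁ : ℝ) ^ (-(1 + (if ∃ j, a j = 2 then 1 else 0)) : ℤ) *
      (M₂ : ℝ) ^ (-(1 + (if ∃ j, b j = 2 then 1 else 0)) : ℤ) := by
  have := unifM_isProbabilityMeasure hM₁
  have := unifM_isProbabilityMeasure hM₂
  have hfactor (x : ((Fin (Nu 0) × Fin (Nu 1) × Fin (Nu 2)) → Fin M₁) ×
      ((Fin (Nv 0) × Fin (Nv 1) × Fin (Nv 2)) → Fin M₂)) :
      ((Finset.univ.filter
        (fun q : (Fin (Nu 0) × Fin (Nu 1) × Fin (Nu 2)) ×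
                 (Fin (Nv 0) × Fin (Nv 1) × Fin (Nv 2)) ×
                 (Fin (Nu 0) × Fin (Nu 1) × Fin (Nu 2)) ×
                 (Fin (Nv 0) × Fin (Nv 1) × Fin (Nv 2)) =>
          x.1 q.1 = ⟨0, hM₁⟩ ∧ x.1 q.2.2.1 = ⟨0, hM₁⟩ ∧
          x.2 q.2.1 = ⟨0, hM₂⟩ ∧ x.2 q.2.2.2 = ⟨0, hM₂⟩ ∧
          (q.1.1 = q.2.2.1.1 ↔ a 0 = 1) ∧
          (q.1.2.1 = q.2.2.1.2.1 ↔ a 1 = 1) ∧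
          (q.1.2.2 = q.2.2.1.2.2 ↔ a 2 = 1) ∧
          (q.2.1.1 = q.2.2.2.1 ↔ b 0 = 1) ∧
          (q.2.1.2.1 = q.2.2.2.2.1 ↔ b 1 = 1) ∧
          (q.2.1.2.2 = q.2.2.2.2.2 ↔ b 2 = 1))).card : ℝ) =
      (((agreementPairs Nu a).filter
          fun p => x.1 p.1 = ⟨0, hM₁⟩ ∧ x.1 p.2 = ⟨0, hM₁⟩).card : ℝ) *
        (((agreementPairs Nv b).filter
          fun p => x.2 p.1 = ⟨0, hM₂⟩ ∧ x.2 p.2 = ⟨0, hM₂⟩).card : ℝ) := by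
    rw [← Nat.cast_mul, ← Finset.card_product]
    congr 1
    refine Finset.card_nbij' (fun q => ((q.1, q.2.2.1), (q.2.1, q.2.2.2)))
      (fun r => (r.1.1, r.2.1, r.1.2, r.2.2)) ?_ ?_ (fun _ _ => rfl) (fun _ _ => rfl)
    · intro q hq
      simp only [agreementPairs, Finset.coe_product, Finset.coe_filter, Finset.mem_filter,
        Finset.mem_univ, true_and, Set.mem_prod, Set.mem_ofPred_eq] at hq ⊢
      obtain ⟨hk, hk', hl, hl', ha0, ha1, ha2, hb0, hb1, hb2⟩ := hq
      exact ⟨⟨⟨ha0, ha1, ha2⟩, hk, hk'⟩, ⟨hb0, hb1, hb2⟩, hl, hl'⟩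
    · intro q hq
      simp only [agreementPairs, Finset.coe_product, Finset.coe_filter, Finset.mem_filter,
        Finset.mem_univ, true_and, Set.mem_prod, Set.mem_ofPred_eq] at hq ⊢
      obtain ⟨⟨⟨ha0, ha1, ha2⟩, hk, hk'⟩, ⟨hb0, hb1, hb2⟩, hl, hl'⟩ := hq
      exact ⟨hk, hk', hl, hl', ha0, ha1, ha2, hb0, hb1, hb2⟩
  simp_rw [hfactor]
  rw [integral_prod_mul
    (fun x : (Fin (Nu 0) × Fin (Nu 1) × Fin (Nu 2)) → Fin M₁ =>
      (((agreementPairs Nu a).filter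
        fun p => x p.1 = ⟨0, hM₁⟩ ∧ x p.2 = ⟨0, hM₁⟩).card : ℝ))
    (fun x : (Fin (Nv 0) × Fin (Nv 1) × Fin (Nv 2)) → Fin M₂ =>
      (((agreementPairs Nv b).filter
        fun p => x p.1 = ⟨0, hM₂⟩ ∧ x p.2 = ⟨0, hM₂⟩).card : ℝ))]
  refine (mul_le_mul (integral_card_agreementPairs_le Nu a ha hM₁ _)
    (integral_card_agreementPairs_le Nv b hb hM₂ _)
    (integral_nonneg fun _ => Nat.cast_nonneg _) (by positivity)).trans_eq ?_
  ring
end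

section
/- Core inequality in the simplification of the distributed decode–forward rate region (converse part of Proposition 1). Let N, L be positive integers and let S ⊆ [N], D ⊆ [L], with S^c = [N] \ S, S^c_k = S^c ∩ [k−1], D_ℓ = D ∩ [ℓ−1]. Let X̃, X̆₁,…,X̆_N, Ũ₁,…,Ũ_N, U₁,…,U_L, X₁,…,X_N, Y̆₁,…,Y̆_N, Y₁,…,Y_L be jointly distributed finite-valued random variables such that: (i) for each k ∈ [N], X_k is almost surely a deterministic function of X̆_k; (ii) for each k ∈ [N], Y̆_k is almost surely a deterministic function of (X̃, X₁,…,X_N); (iii) (X̃, X̆₁,…,X̆_N, Ũ₁,…,Ũ_N, U₁,…,U_L) — (X₁,…,X_N) — (Y₁,…,Y_L) forms a Markov chain. Then I(X̃, X̆(S); Ũ(S^c), U(D) | X̆(S^c)) − Σ_{k∈S^c} [ I(Ũ_k; Ũ(S^c_k), X̃, X̆₁,…,X̆_N | X̆_k, Y̆_k) + I(X̆_k; X̆(S^c_k)) ] − Σ_{ℓ∈D} I(U_ℓ; U(D_ℓ), Ũ(S^c), X̃, X̆₁,…,X̆_N | Y_ℓ) ≤ Σ_{ℓ∈D} I(U_ℓ;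 Y_ℓ) + Σ_{k∈S^c} H(Y̆_k) − Σ_{k∈S^c} I(X_k; X(S^c_k)) − Σ_{ℓ∈D} I(U_ℓ; U(D_ℓ), X(S^c)). -/
open MeasureTheory

/-- Shannon entropy (in bits) of a finite-valued random variable `X` on `(Ω, μ)`:
`H(X) = −Σ_a P(X = a) · log₂ P(X = a)` (with the convention `0 · log₂ 0 = 0`). -/
noncomputable def entH {Ω : Type*} [MeasurableSpace Ω] {α : Type*} [Fintype α]
    (μ : Measure Ω) (X : Ω → α) : ℝ :=
  -∑ a : α, (μ (X ⁻¹' {a})).toReal * Real.logb 2 (μ (X ⁻¹' {a})).toReal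

/-- Conditional entropy `H(X | Y) = H(X, Y) − H(Y)`. -/
noncomputable def condEntH {Ω : Type*} [MeasurableSpace Ω] {α β : Type*} [Fintype α] [Fintype β]
    (μ : Measure Ω) (X : Ω → α) (Y : Ω → β) : ℝ :=
  entH μ (fun ω => (X ω, Y ω)) - entH μ Y

/-- Mutual information `I(X; Y) = H(X) + H(Y) − H(X, Y)`. -/
noncomputable def miH {Ω : Type*} [MeasurableSpace Ω] {α β : Type*} [Fintype α] [Fintype β]
    (μ : Measure Ω) (X : Ω → α) (Y : Ω → β) : ℝ :=
  entH μ X + entH μ Y - entH μ (fun ω => (X ω, Y ω))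

/-- Conditional mutual information `I(X; Y | Z) = H(X|Z) + H(Y|Z) − H(X,Y|Z)`. -/
noncomputable def cmiH {Ω : Type*} [MeasurableSpace Ω] {α β γ : Type*}
    [Fintype α] [Fintype β] [Fintype γ]
    (μ : Measure Ω) (X : Ω → α) (Y : Ω → β) (Z : Ω → γ) : ℝ :=
  condEntH μ X Z + condEntH μ Y Z - condEntH μ (fun ω => (X ω, Y ω)) Z

section EntropyLemmas

variable {Ω : Type*} [MeasurableSpace Ω] {μ : Measure Ω}

/-- The entropy of a function of `W`, written as a sum over the values of `W`. -/
theorem entH_comp {α β : Type*} [Fintype α] [Fintype β] [MeasurableSpace β]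
    [MeasurableSingletonClass β] [IsProbabilityMeasure μ] {W : Ω → β} (hW : Measurable W)
    (f : β → α) :
    entH μ (fun ω => f (W ω)) =
      -∑ w, μ.real (W ⁻¹' {w}) * Real.logb 2 (μ.real ((fun ω => f (W ω)) ⁻¹' {f w})) := by
  classical
  have hq (a : α) : μ.real ((fun ω => f (W ω)) ⁻¹' {a})
      = ∑ w with f w = a, μ.real (W ⁻¹' {w}) := by
    rw [← measureReal_biUnion_finset]
    · congr 1
      ext ω
      simp
    · intro a _ b _ hab
      exact Disjoint.preimage _ (by simpa using hab)
    · intro b _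
      exact hW (measurableSet_singleton b)
  unfold entH
  congr 1
  rw [← Finset.sum_fiberwise Finset.univ f]
  refine Finset.sum_congr rfl fun a _ => ?_
  change μ.real _ * Real.logb 2 (μ.real _) = _
  conv_lhs => rw [hq a, Finset.sum_mul, ← hq a]
  refine Finset.sum_congr rfl fun w hw => ?_
  rw [(Finset.mem_filter.1 hw).2]

/-- Entropy is monotone: if `Y` determines `X` then `H(X) ≤ H(Y)`. -/
theorem entH_mono [IsProbabilityMeasure μ] {α β : Type*} [Fintype α] [Fintype β]
    [MeasurableSpace β] [MeasurableSingletonClass β] {X : Ω → α} {Y : Ω → β} (hY : Measurable Y)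
    (h : ∀ ω ω', Y ω = Y ω' → X ω = X ω') : entH μ X ≤ entH μ Y := by
  obtain ⟨ω₀⟩ : Nonempty Ω := nonempty_of_isProbabilityMeasure μ
  have : Nonempty α := ⟨X ω₀⟩
  obtain ⟨f, rfl⟩ := (Function.factorsThrough_iff X).1 fun _ _ hab => h _ _ hab
  have h₁ := entH_comp (μ := μ) hY f
  have h₂ := entH_comp (μ := μ) hY id
  simp only [id] at h₂
  change entH μ (fun ω => f (Y ω)) ≤ entH μ (fun ω => Y ω)
  rw [h₁, h₂]
  refine neg_le_neg (Finset.sum_le_sum fun w _ => ?_)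
  rcases (measureReal_nonneg (μ := μ) (s := Y ⁻¹' {w})).eq_or_lt with h0 | h0
  · rw [← h0]; simp
  · refine mul_le_mul_of_nonneg_left (Real.logb_le_logb_of_le one_lt_two h0 ?_) h0.le
    refine measureReal_mono fun ω hω => ?_
    simp only [Set.mem_preimage, Set.mem_singleton_iff] at hω ⊢
    rw [hω]

/-- Variables that determine each other have the same entropy. -/
theorem entH_congr [IsProbabilityMeasure μ] {α β : Type*} [Fintype α] [Fintype β]
    [MeasurableSpace α] [MeasurableSingletonClass α]
    [MeasurableSpace β] [MeasurableSingletonClass β] {X : Ω → α} {Y : Ω → β}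
    (hX : Measurable X) (hY : Measurable Y)
    (h : ∀ ω ω', X ω = X ω' ↔ Y ω = Y ω') : entH μ X = entH μ Y :=
  le_antisymm (entH_mono hY fun _ _ => (h _ _).2) (entH_mono hX fun _ _ => (h _ _).1)

/-- A variable with values in `Unit` has no entropy. -/
theorem entH_unit [IsProbabilityMeasure μ] (X : Ω → Unit) : entH μ X = 0 := by
  have : X ⁻¹' {()} = Set.univ := by ext; simp
  simp [entH, this]

/-- Submodularity of entropy: if `P` and `Q` each determine `R`, and together determine `J`,
then `H(J) + H(R) ≤ H(P) + H(Q)`. -/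
theorem entH_submodular [IsProbabilityMeasure μ] {α β γ δ : Type*}
    [Fintype α] [Fintype β] [Fintype γ] [Fintype δ]
    [MeasurableSpace α] [MeasurableSingletonClass α]
    [MeasurableSpace β] [MeasurableSingletonClass β]
    {P : Ω → α} {Q : Ω → β} {R : Ω → γ} {J : Ω → δ} (hP : Measurable P) (hQ : Measurable Q)
    (hPR : ∀ ω ω', P ω = P ω' → R ω = R ω') (hQR : ∀ ω ω', Q ω = Q ω' → R ω = R ω')
    (hJ : ∀ ω ω', P ω = P ω' → Q ω = Q ω' → J ω = J ω') :
    entH μ J + entH μ R ≤ entH μ P + entH μ Q := by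
  classical
  have hW : Measurable fun ω => (P ω, Q ω) := hP.prodMk hQ
  have hJW : entH μ J ≤ entH μ (fun ω => (P ω, Q ω)) :=
    entH_mono hW fun ω ω' h => hJ _ _ (Prod.ext_iff.1 h).1 (Prod.ext_iff.1 h).2
  obtain ⟨ω₀⟩ : Nonempty Ω := nonempty_of_isProbabilityMeasure μ
  have : Nonempty γ := ⟨R ω₀⟩
  obtain ⟨f, hf⟩ := (Function.factorsThrough_iff R).1 fun _ _ hab => hPR _ _ hab
  obtain ⟨g, hg⟩ := (Function.factorsThrough_iff R).1 fun _ _ hab => hQR _ _ hab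
  have hfR : (fun ω => f (P ω)) = R := hf.symm
  have hgR : (fun ω => g (Q ω)) = R := hg.symm
  set p : α × β → ℝ := fun w => μ.real ((fun ω => (P ω, Q ω)) ⁻¹' {w}) with hp
  set pP : α → ℝ := fun a => μ.real (P ⁻¹' {a}) with hpP
  set pQ : β → ℝ := fun b => μ.real (Q ⁻¹' {b}) with hpQ
  set pR : γ → ℝ := fun c => μ.real (R ⁻¹' {c}) with hpR
  have eW : entH μ (fun ω => (P ω, Q ω)) = -∑ w, p w * Real.logb 2 (p w) := entH_comp hW id
  have eP : entH μ P = -∑ w, p w * Real.logb 2 (pP w.1) := entH_comp hW Prod.fst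
  have eQ : entH μ Q = -∑ w, p w * Real.logb 2 (pQ w.2) := entH_comp hW Prod.snd
  have eR : entH μ R = -∑ w, p w * Real.logb 2 (pR (f w.1)) := by
    have := entH_comp (μ := μ) hW (fun w => f w.1)
    simp only [hfR] at this
    exact this
  have pnn (w : α × β) : 0 ≤ p w := measureReal_nonneg
  have pPnn (a : α) : 0 ≤ pP a := measureReal_nonneg
  have pQnn (b : β) : 0 ≤ pQ b := measureReal_nonneg
  have pRnn (c : γ) : 0 ≤ pR c := measureReal_nonneg
  have psum : ∑ w, p w = 1 := by
    rw [hp, sum_measureReal_preimage_singleton _ fun w _ => hW (measurableSet_singleton w)]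
    simp
  have pPsum : ∑ a, pP a = 1 := by
    rw [hpP, sum_measureReal_preimage_singleton _ fun w _ => hP (measurableSet_singleton w)]
    simp
  have pQsum (c : γ) : ∑ b with g b = c, pQ b = pR c := by
    rw [hpQ, sum_measureReal_preimage_singleton _ fun w _ => hQ (measurableSet_singleton w)]
    simp only [hpR, ← hgR]
    congr 1
    ext ω
    simp
  have key : ∑ w, p w * (Real.logb 2 (pP w.1) + Real.logb 2 (pQ w.2)
      - Real.logb 2 (p w) - Real.logb 2 (pR (f w.1))) ≤ 0 := by
    have hterm (w : α × β) : p w * (Real.logb 2 (pP w.1) + Real.logb 2 (pQ w.2)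
        - Real.logb 2 (p w) - Real.logb 2 (pR (f w.1)))
        ≤ ((if g w.2 = f w.1 then pP w.1 * pQ w.2 / pR (f w.1) else 0) - p w) / Real.log 2 := by
      have hlog : 0 < Real.log 2 := Real.log_pos one_lt_two
      rcases (pnn w).eq_or_lt with h0 | h0
      · rw [← h0, zero_mul, sub_zero]
        refine div_nonneg ?_ hlog.le
        split_ifs
        · exact div_nonneg (mul_nonneg (pPnn _) (pQnn _)) (pRnn _)
        · exact le_rfl
      · have hsP : p w ≤ pP w.1 := measureReal_mono fun ω hω => by
          simp only [Set.mem_preimage, Set.mem_singleton_iff] at hω ⊢; rw [← hω]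
        have hsQ : p w ≤ pQ w.2 := measureReal_mono fun ω hω => by
          simp only [Set.mem_preimage, Set.mem_singleton_iff] at hω ⊢; rw [← hω]
        have hsR : p w ≤ pR (f w.1) := measureReal_mono fun ω hω => by
          simp only [Set.mem_preimage, Set.mem_singleton_iff] at hω ⊢
          rw [← hω, ← congrFun hfR ω]
        have hfg : g w.2 = f w.1 := by
          obtain ⟨ω, hω⟩ : ((fun ω => (P ω, Q ω)) ⁻¹' {w}).Nonempty :=
            nonempty_of_measureReal_ne_zero h0.ne'
          simp only [Set.mem_preimage, Set.mem_singleton_iff] at hω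
          rw [← hω]
          exact (congrFun hgR ω).trans (congrFun hfR ω).symm
        have hP0 := h0.trans_le hsP
        have hQ0 := h0.trans_le hsQ
        have hR0 := h0.trans_le hsR
        rw [if_pos hfg, le_div_iff₀ hlog]
        set t := pP w.1 * pQ w.2 / pR (f w.1)
        have ht : 0 < t := by positivity
        have e : (Real.logb 2 (pP w.1) + Real.logb 2 (pQ w.2)
            - Real.logb 2 (p w) - Real.logb 2 (pR (f w.1))) * Real.log 2
            = Real.log (t / p w) := by
          rw [Real.log_div ht.ne' h0.ne', Real.log_div (by positivity) hR0.ne',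
            Real.log_mul hP0.ne' hQ0.ne']
          simp only [Real.logb]
          field_simp
          ring
        rw [mul_assoc, e]
        calc p w * Real.log (t / p w) ≤ p w * (t / p w - 1) :=
              mul_le_mul_of_nonneg_left (Real.log_le_sub_one_of_pos (by positivity)) h0.le
          _ = t - p w := by field_simp
    refine (Finset.sum_le_sum fun w _ => hterm w).trans ?_
    rw [← Finset.sum_div, Finset.sum_sub_distrib, psum, Fintype.sum_prod_type]
    refine div_nonpos_of_nonpos_of_nonneg ?_ (Real.log_nonneg one_le_two)
    rw [← pPsum, sub_nonpos]
    refine Finset.sum_le_sum fun a _ => ?_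
    dsimp only
    rw [← Finset.sum_filter, ← Finset.sum_div, ← Finset.mul_sum, pQsum]
    rcases (pRnn (f a)).eq_or_lt with h0 | h0
    · rw [← h0]; simpa using pPnn a
    · rw [mul_div_assoc, div_self h0.ne', mul_one]
  simp only [mul_sub, mul_add, Finset.sum_sub_distrib, Finset.sum_add_distrib] at key
  linarith

/-- The chain rule for the entropy of a tuple, along the order of its index set. -/
theorem sum_entH_chain [IsProbabilityMeasure μ] {ι : Type*} [Fintype ι] [LinearOrder ι]
    {τ : ι → Type*} [∀ k, Fintype (τ k)] [∀ k, MeasurableSpace (τ k)]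
    [∀ k, MeasurableSingletonClass (τ k)] {V : ∀ k, Ω → τ k} (hV : ∀ k, Measurable (V k))
    {δ : Type*} [Fintype δ] [MeasurableSpace δ] [MeasurableSingletonClass δ] {C : Ω → δ}
    (hC : Measurable C) (T : Finset ι) :
    ∑ k ∈ T, (entH μ (fun ω => (V k ω, (fun j : {j // j ∈ T ∧ j < k} => V j.1 ω), C ω))
        - entH μ (fun ω => ((fun j : {j // j ∈ T ∧ j < k} => V j.1 ω), C ω)))
      = entH μ (fun ω => ((fun j : {j // j ∈ T} => V j.1 ω), C ω)) - entH μ C := by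
  induction T using Finset.induction_on_max with
  | empty =>
    rw [Finset.sum_empty, eq_comm, sub_eq_zero]
    exact entH_congr (by fun_prop) hC (by simp [funext_iff])
  | insert a s hs ih =>
    have ha : a ∉ s := fun h => lt_irrefl _ (hs a h)
    have hlt (k : ι) (hk : k ∈ s) (j : ι) : (j ∈ insert a s ∧ j < k) ↔ (j ∈ s ∧ j < k) := by
      have := hs k hk
      grind
    have hlta (j : ι) : (j ∈ insert a s ∧ j < a) ↔ j ∈ s := by grind
    have e₁ : ∑ k ∈ s,
        (entH μ (fun ω => (V k ω, (fun j : {j // j ∈ insert a s ∧ j < k} => V j.1 ω), C ω))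
          - entH μ (fun ω => ((fun j : {j // j ∈ insert a s ∧ j < k} => V j.1 ω), C ω)))
        = ∑ k ∈ s, (entH μ (fun ω => (V k ω, (fun j : {j // j ∈ s ∧ j < k} => V j.1 ω), C ω))
          - entH μ (fun ω => ((fun j : {j // j ∈ s ∧ j < k} => V j.1 ω), C ω))) := by
      refine Finset.sum_congr rfl fun k hk => ?_
      congr 1
      · exact entH_congr (by fun_prop) (by fun_prop) fun ω ω' => by
          simp only [Prod.mk.injEq, funext_iff, Subtype.forall, hlt k hk]
      · exact entH_congr (by fun_prop) (by fun_prop) fun ω ω' => by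
          simp only [Prod.mk.injEq, funext_iff, Subtype.forall, hlt k hk]
    have e₂ : entH μ (fun ω => (V a ω, (fun j : {j // j ∈ insert a s ∧ j < a} => V j.1 ω), C ω))
        = entH μ (fun ω => ((fun j : {j // j ∈ insert a s} => V j.1 ω), C ω)) :=
      entH_congr (by fun_prop) (by fun_prop) fun ω ω' => by
        simp only [Prod.mk.injEq, funext_iff, Subtype.forall, hlta, Finset.forall_mem_insert,
          and_assoc]
    have e₃ : entH μ (fun ω => ((fun j : {j // j ∈ insert a s ∧ j < a} => V j.1 ω), C ω))
        = entH μ (fun ω => ((fun j : {j // j ∈ s} => V j.1 ω), C ω)) :=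
      entH_congr (by fun_prop) (by fun_prop) fun ω ω' => by
        simp only [Prod.mk.injEq, funext_iff, Subtype.forall, hlta]
    rw [Finset.sum_insert ha, e₁, ih, e₂, e₃]
    ring

/-- The chain rule `∑ I(V_k; V(T_k)) = ∑ H(V_k) - H(V(T))`. -/
theorem sum_miH_chain [IsProbabilityMeasure μ] {ι : Type*} [Fintype ι] [LinearOrder ι]
    {τ : ι → Type*} [∀ k, Fintype (τ k)] [∀ k, MeasurableSpace (τ k)]
    [∀ k, MeasurableSingletonClass (τ k)] {V : ∀ k, Ω → τ k} (hV : ∀ k, Measurable (V k))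
    (T : Finset ι) :
    ∑ k ∈ T, miH μ (V k) (fun ω => fun j : {j // j ∈ T ∧ j < k} => V j.1 ω)
      = ∑ k ∈ T, entH μ (V k) - entH μ (fun ω => fun j : {j // j ∈ T} => V j.1 ω) := by
  have h := sum_entH_chain (μ := μ) hV (C := fun _ => ()) measurable_const T
  have e : entH μ (fun ω => ((fun j : {j // j ∈ T} => V j.1 ω), ()))
      = entH μ (fun ω => fun j : {j // j ∈ T} => V j.1 ω) :=
    entH_congr (by fun_prop) (by fun_prop) (by simp)
  rw [entH_unit, sub_zero, e] at h
  rw [← h, ← Finset.sum_sub_distrib]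
  refine Finset.sum_congr rfl fun k _ => ?_
  have e₁ : entH μ (fun ω => (V k ω, (fun j : {j // j ∈ T ∧ j < k} => V j.1 ω), ()))
      = entH μ (fun ω => (V k ω, (fun j : {j // j ∈ T ∧ j < k} => V j.1 ω))) :=
    entH_congr (by fun_prop) (by fun_prop) (by simp)
  have e₂ : entH μ (fun ω => ((fun j : {j // j ∈ T ∧ j < k} => V j.1 ω), ()))
      = entH μ (fun ω => (fun j : {j // j ∈ T ∧ j < k} => V j.1 ω)) :=
    entH_congr (by fun_prop) (by fun_prop) (by simp)
  rw [e₁, e₂, miH]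
  ring

/-- Subadditivity of conditional entropy, where in each summand the conditioning variable `C` is
weakened to a function `Z_k` of it. -/
theorem entH_pi_sub_le_sum [IsProbabilityMeasure μ] {ι : Type*} [Fintype ι] [DecidableEq ι]
    {τ ζ : ι → Type*} [∀ k, Fintype (τ k)] [∀ k, MeasurableSpace (τ k)]
    [∀ k, MeasurableSingletonClass (τ k)] [∀ k, Fintype (ζ k)] [∀ k, MeasurableSpace (ζ k)]
    [∀ k, MeasurableSingletonClass (ζ k)] {V : ∀ k, Ω → τ k} (hV : ∀ k, Measurable (V k))
    {Z : ∀ k, Ω → ζ k} (hZ : ∀ k, Measurable (Z k))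
    {δ : Type*} [Fintype δ] [MeasurableSpace δ] [MeasurableSingletonClass δ] {C : Ω → δ}
    (hC : Measurable C) (T : Finset ι) (hCZ : ∀ k ∈ T, ∀ ω ω', C ω = C ω' → Z k ω = Z k ω') :
    entH μ (fun ω => ((fun j : {j // j ∈ T} => V j.1 ω), C ω)) - entH μ C
      ≤ ∑ k ∈ T, condEntH μ (V k) (Z k) := by
  induction T using Finset.induction_on with
  | empty =>
    rw [Finset.sum_empty, sub_nonpos]
    exact entH_mono hC (by simp [funext_iff])
  | insert a s ha ih =>
    rw [Finset.sum_insert ha]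
    have h₁ := ih fun k hk => hCZ k (Finset.mem_insert_of_mem hk)
    have h₂ : entH μ (fun ω => ((fun j : {j // j ∈ insert a s} => V j.1 ω), C ω)) + entH μ (Z a)
        ≤ entH μ (fun ω => (V a ω, Z a ω))
          + entH μ (fun ω => ((fun j : {j // j ∈ s} => V j.1 ω), C ω)) := by
      refine entH_submodular (by fun_prop) (by fun_prop) (by simp)
        (fun ω ω' h => hCZ a (Finset.mem_insert_self _ _) _ _ (Prod.ext_iff.1 h).2) ?_
      simp only [Prod.mk.injEq, funext_iff, Subtype.forall, Finset.forall_mem_insert]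
      tauto
    unfold condEntH at h₁ ⊢
    linarith

/-- Dropping `Z` from the second conditioning: `H(V|Z) - H(V|B) ≤ I(V; B | Z)`. -/
theorem le_cmiH [IsProbabilityMeasure μ] {α β γ : Type*} [Fintype α] [Fintype β] [Fintype γ]
    [MeasurableSpace α] [MeasurableSingletonClass α]
    [MeasurableSpace β] [MeasurableSingletonClass β]
    [MeasurableSpace γ] [MeasurableSingletonClass γ]
    {V : Ω → α} {B : Ω → β} {Z : Ω → γ} (hV : Measurable V) (hB : Measurable B)
    (hZ : Measurable Z) :
    condEntH μ V Z - (entH μ (fun ω => (V ω, B ω)) - entH μ B) ≤ cmiH μ V B Z := by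
  have h : entH μ (fun ω => ((V ω, B ω), Z ω)) + entH μ B
      ≤ entH μ (fun ω => (V ω, B ω)) + entH μ (fun ω => (B ω, Z ω)) :=
    entH_submodular (by fun_prop) (by fun_prop) (by simp) (by simp +contextual) (by simp; tauto)
  unfold cmiH condEntH
  linarith

end EntropyLemmas

/-- Core inequality in the simplification of the distributed decode–forward rate region
(converse part of Proposition 1). Here `Xt = X̃`, `Xb k = X̆_k`, `Ut k = Ũ_k`, `Yb k = Y̆_k`,
`Sᶜ_k = Sᶜ ∩ {j | j < k}` and `D_ℓ = D ∩ {m | m < ℓ}`. The hypotheses are: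
(i) each `X_k` is a.s. a deterministic function of `X̆_k`; (ii) each `Y̆_k` is a.s. a
deterministic function of `(X̃, X₁,…,X_N)`; (iii) the Markov chain
`(X̃, X̆^N, Ũ^N, U^L) — X^N — Y^L`. -/
theorem stmt_4 {Ω : Type*} [MeasurableSpace Ω] (μ : Measure Ω) [IsProbabilityMeasure μ]
    (N L : ℕ) (hN : 0 < N) (hL : 0 < L)
    {γ : Type*} [Fintype γ] [MeasurableSpace γ] [MeasurableSingletonClass γ]
    {κ τ χ ψ : Fin N → Type*} {υ ρ : Fin L → Type*}
    [∀ k, Fintype (κ k)] [∀ k, Fintype (τ k)] [∀ k, Fintype (χ k)] [∀ k, Fintype (ψ k)]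
    [∀ l, Fintype (υ l)] [∀ l, Fintype (ρ l)]
    [∀ k, MeasurableSpace (κ k)] [∀ k, MeasurableSingletonClass (κ k)]
    [∀ k, MeasurableSpace (τ k)] [∀ k, MeasurableSingletonClass (τ k)]
    [∀ k, MeasurableSpace (χ k)] [∀ k, MeasurableSingletonClass (χ k)]
    [∀ k, MeasurableSpace (ψ k)] [∀ k, MeasurableSingletonClass (ψ k)]
    [∀ l, MeasurableSpace (υ l)] [∀ l, MeasurableSingletonClass (υ l)]
    [∀ l, MeasurableSpace (ρ l)] [∀ l, MeasurableSingletonClass (ρ l)]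
    (Xt : Ω → γ) (Xb : ∀ k, Ω → κ k) (Ut : ∀ k, Ω → τ k) (U : ∀ l, Ω → υ l)
    (X : ∀ k, Ω → χ k) (Yb : ∀ k, Ω → ψ k) (Y : ∀ l, Ω → ρ l)
    (hXt : Measurable Xt) (hXb : ∀ k, Measurable (Xb k)) (hUt : ∀ k, Measurable (Ut k))
    (hU : ∀ l, Measurable (U l)) (hX : ∀ k, Measurable (X k))
    (hYb : ∀ k, Measurable (Yb k)) (hY : ∀ l, Measurable (Y l))
    (hdet1 : ∀ k, condEntH μ (X k) (Xb k) = 0)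
    (hdet2 : ∀ k, condEntH μ (Yb k) (fun ω => (Xt ω, fun j : Fin N => X j ω)) = 0)
    (hMarkov : cmiH μ
      (fun ω => (Xt ω, (fun k : Fin N => Xb k ω), (fun k : Fin N => Ut k ω),
                 (fun l : Fin L => U l ω)))
      (fun ω => fun l : Fin L => Y l ω)
      (fun ω => fun k : Fin N => X k ω) = 0)
    (S : Finset (Fin N)) (D : Finset (Fin L)) :
    cmiH μ (fun ω => (Xt ω, fun k : {k // k ∈ S} => Xb k.1 ω))
        (fun ω => ((fun k : {k // k ∈ Sᶜ} => Ut k.1 ω), (fun l : {l // l ∈ D} => U l.1 ω)))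
        (fun ω => fun k : {k // k ∈ Sᶜ} => Xb k.1 ω)
      - (∑ k ∈ Sᶜ,
          (cmiH μ (Ut k)
            (fun ω => ((fun j : {j // j ∈ Sᶜ ∧ j < k} => Ut j.1 ω), Xt ω,
                       (fun j : Fin N => Xb j ω)))
            (fun ω => (Xb k ω, Yb k ω))
          + miH μ (Xb k) (fun ω => fun j : {j // j ∈ Sᶜ ∧ j < k} => Xb j.1 ω)))
      - (∑ l ∈ D,
          cmiH μ (U l)
            (fun ω => ((fun m : {m // m ∈ D ∧ m < l} => U m.1 ω),
                       (fun k : {k // k ∈ Sᶜ} => Ut k.1 ω), Xt ω,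
                       (fun k : Fin N => Xb k ω)))
            (Y l))
    ≤ (∑ l ∈ D, miH μ (U l) (Y l))
      + (∑ k ∈ Sᶜ, entH μ (Yb k))
      - (∑ k ∈ Sᶜ, miH μ (X k) (fun ω => fun j : {j // j ∈ Sᶜ ∧ j < k} => X j.1 ω))
      - (∑ l ∈ D, miH μ (U l)
          (fun ω => ((fun m : {m // m ∈ D ∧ m < l} => U m.1 ω),
                     (fun k : {k // k ∈ Sᶜ} => X k.1 ω)))) := by
  have hrelay (k : Fin N) : condEntH μ (fun ω => (Ut k ω, Xb k ω)) (X k)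
      - (entH μ (fun ω => (Ut k ω, (fun j : {j // j ∈ Sᶜ ∧ j < k} => Ut j.1 ω), Xt ω,
            fun j : Fin N => Xb j ω))
        - entH μ (fun ω => ((fun j : {j // j ∈ Sᶜ ∧ j < k} => Ut j.1 ω), Xt ω,
            fun j : Fin N => Xb j ω)))
      ≤ cmiH μ (Ut k) (fun ω => ((fun j : {j // j ∈ Sᶜ ∧ j < k} => Ut j.1 ω), Xt ω,
            (fun j : Fin N => Xb j ω))) (fun ω => (Xb k ω, Yb k ω))
        + entH μ (Yb k) + entH μ (Xb k) - entH μ (X k) := by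
    have h₁ := le_cmiH (μ := μ) (hUt k)
      (B := fun ω => ((fun j : {j // j ∈ Sᶜ ∧ j < k} => Ut j.1 ω), Xt ω,
            (fun j : Fin N => Xb j ω))) (Z := fun ω => (Xb k ω, Yb k ω))
      (by fun_prop) (by fun_prop)
    have h₂ : entH μ (fun ω => (Xb k ω, Yb k ω)) + entH μ (fun _ => ())
        ≤ entH μ (Xb k) + entH μ (Yb k) :=
      entH_submodular (hXb k) (hYb k) (by simp) (by simp) (by simp +contextual)
    have h₃ : entH μ (fun ω => ((Ut k ω, Xb k ω), X k ω)) + entH μ (Xb k)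
        ≤ entH μ (fun ω => (Ut k ω, Xb k ω)) + entH μ (fun ω => (X k ω, Xb k ω)) :=
      entH_submodular (by fun_prop) (by fun_prop) (by simp) (by simp) (by simp; tauto)
    have h₄ : entH μ (fun ω => (Ut k ω, Xb k ω)) ≤ entH μ (fun ω => (Ut k ω, Xb k ω, Yb k ω)) :=
      entH_mono (by fun_prop) (by simp; tauto)
    have h₅ := hdet1 k
    rw [entH_unit] at h₂
    unfold condEntH at h₁ h₅ ⊢
    linarith
  have hrelays := Finset.sum_le_sum fun k (_ : k ∈ Sᶜ) => hrelay k
  have hdest := Finset.sum_le_sum fun l (_ : l ∈ D) => le_cmiH (μ := μ) (hU l)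
    (B := fun ω => ((fun m : {m // m ∈ D ∧ m < l} => U m.1 ω),
      (fun k : {k // k ∈ Sᶜ} => Ut k.1 ω), Xt ω, (fun k : Fin N => Xb k ω)))
    (by fun_prop) (hY l)
  have cUt := sum_entH_chain (μ := μ) hUt (C := fun ω => (Xt ω, fun j : Fin N => Xb j ω))
    (by fun_prop) Sᶜ
  have cU := sum_entH_chain (μ := μ) hU (C := fun ω => ((fun k : {k // k ∈ Sᶜ} => Ut k.1 ω), Xt ω,
    fun k : Fin N => Xb k ω)) (by fun_prop) D
  have cUX := sum_entH_chain (μ := μ) hU (C := fun ω => fun k : {k // k ∈ Sᶜ} => X k.1 ω)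
    (by fun_prop) D
  have hsub := entH_pi_sub_le_sum (μ := μ) (V := fun k ω => (Ut k ω, Xb k ω)) (Z := X)
    (fun k => by fun_prop) hX
    (C := fun ω => ((fun l : {l // l ∈ D} => U l.1 ω), fun k : {k // k ∈ Sᶜ} => X k.1 ω))
    (by fun_prop) Sᶜ (fun k hk ω ω' h => congrFun (Prod.ext_iff.1 h).2 ⟨k, hk⟩)
  have hmono : entH μ (fun ω => (((fun k : {k // k ∈ Sᶜ} => Ut k.1 ω),
        (fun l : {l // l ∈ D} => U l.1 ω)), fun k : {k // k ∈ Sᶜ} => Xb k.1 ω))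
      ≤ entH μ (fun ω => ((fun k : {k // k ∈ Sᶜ} => (Ut k.1 ω, Xb k.1 ω)),
        (fun l : {l // l ∈ D} => U l.1 ω), fun k : {k // k ∈ Sᶜ} => X k.1 ω)) := by
    refine entH_mono (by fun_prop) ?_
    simp only [Prod.mk.injEq, funext_iff, Subtype.forall]
    exact fun ω ω' h => ⟨⟨fun k hk => (h.1 k hk).1, h.2.1⟩, fun k hk => (h.1 k hk).2⟩
  have eXb : entH μ (fun ω => ((Xt ω, fun k : {k // k ∈ S} => Xb k.1 ω),
        fun k : {k // k ∈ Sᶜ} => Xb k.1 ω))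
      = entH μ (fun ω => (Xt ω, fun k : Fin N => Xb k ω)) := by
    refine entH_congr (by fun_prop) (by fun_prop) ?_
    simp only [Prod.mk.injEq, funext_iff, Subtype.forall, Finset.mem_compl]
    exact fun ω ω' => ⟨fun h => ⟨h.1.1, fun k => (em (k ∈ S)).elim (h.1.2 k) (h.2 k)⟩,
      fun h => ⟨⟨h.1, fun k _ => h.2 k⟩, fun k _ => h.2 k⟩⟩
  have eAll : entH μ (fun ω => (((Xt ω, fun k : {k // k ∈ S} => Xb k.1 ω),
        ((fun k : {k // k ∈ Sᶜ} => Ut k.1 ω), (fun l : {l // l ∈ D} => U l.1 ω))),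
        fun k : {k // k ∈ Sᶜ} => Xb k.1 ω))
      = entH μ (fun ω => ((fun l : {l // l ∈ D} => U l.1 ω),
        (fun k : {k // k ∈ Sᶜ} => Ut k.1 ω), Xt ω, fun k : Fin N => Xb k ω)) := by
    refine entH_congr (by fun_prop) (by fun_prop) ?_
    simp only [Prod.mk.injEq, funext_iff, Subtype.forall, Finset.mem_compl]
    exact fun ω ω' => ⟨fun h => ⟨h.1.2.2, h.1.2.1, h.1.1.1,
        fun k => (em (k ∈ S)).elim (h.1.1.2 k) (h.2 k)⟩,
      fun h => ⟨⟨⟨h.2.2.1, fun k _ => h.2.2.2 k⟩, h.2.1, h.1⟩, fun k _ => h.2.2.2 k⟩⟩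
  have mUX : ∑ l ∈ D, miH μ (U l) (fun ω => ((fun m : {m // m ∈ D ∧ m < l} => U m.1 ω),
        (fun k : {k // k ∈ Sᶜ} => X k.1 ω)))
      = ∑ l ∈ D, entH μ (U l) - (entH μ (fun ω => ((fun l : {l // l ∈ D} => U l.1 ω),
          fun k : {k // k ∈ Sᶜ} => X k.1 ω)) - entH μ (fun ω => fun k : {k // k ∈ Sᶜ} => X k.1 ω))
      := by
    rw [← cUX, ← Finset.sum_sub_distrib]
    refine Finset.sum_congr rfl fun l _ => ?_
    unfold miH
    ring
  have mUY : ∑ l ∈ D, miH μ (U l) (Y l)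
      = ∑ l ∈ D, entH μ (U l) - ∑ l ∈ D, condEntH μ (U l) (Y l) := by
    rw [← Finset.sum_sub_distrib]
    refine Finset.sum_congr rfl fun l _ => ?_
    unfold miH condEntH
    ring
  rw [Finset.sum_add_distrib, sum_miH_chain hXb, sum_miH_chain hX, mUX, mUY]
  rw [Finset.sum_sub_distrib, cU] at hdest
  rw [Finset.sum_sub_distrib, cUt, Finset.sum_sub_distrib, Finset.sum_add_distrib,
    Finset.sum_add_distrib] at hrelays
  unfold cmiH condEntH at *
  linarith
end

section
/- For any two real n×n positive semidefinite matrices A and B and any real P > 0, det(I + A·B) ≤ det(I + P·A) · det(I + P^{−1}·B). -/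
open scoped ComplexOrder MatrixOrder in
/-- Every real positive semidefinite matrix is a Gram matrix. -/
theorem Matrix.PosSemidef.exists_eq_transpose_mul_self {m : Type*} [Fintype m] [DecidableEq m]
    {A : Matrix m m ℝ} (hA : A.PosSemidef) : ∃ S : Matrix m m ℝ, A = S.transpose * S :=
  CStarAlgebra.nonneg_iff_eq_star_mul_self.mp hA.nonneg

/-- The determinant does not decrease when a positive semidefinite matrix is added to a
positive definite one. -/
theorem Matrix.PosDef.det_le_det_add {m : Type*} [Fintype m] [DecidableEq m]
    {M Y : Matrix m m ℝ} (hM : M.PosDef) (hY : Y.PosSemidef) : M.det ≤ (M + Y).det := by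
  obtain ⟨k, v, rfl⟩ := posSemidef_iff_eq_sum_vecMulVec.mp hY
  clear hY
  induction k generalizing M with
  | zero => simp
  | succ k ih =>
    rw [Fin.sum_univ_succ, ← add_assoc]
    refine le_trans ?_ (ih (hM.add_posSemidef (posSemidef_vecMulVec_self_star (v 0))) _)
    have hv := hM.inv.posSemidef.dotProduct_mulVec_nonneg (v 0)
    rw [vecMulVec_eq Unit, det_add_replicateCol_mul_replicateRow hM.det_pos.ne'.isUnit,
      ← replicateRow_vecMul, det_unique (n := Unit), add_apply, one_apply_eq,
      replicateRow_mul_replicateCol_apply, ← dotProduct_mulVec]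
    nlinarith [hM.det_pos]

/-- For positive semidefinite `A` and `B`, `det (1 + A * B) ≤ det (1 + A) * det (1 + B)`. -/
theorem Matrix.PosSemidef.det_one_add_mul_le {m : Type*} [Fintype m] [DecidableEq m]
    {A B : Matrix m m ℝ} (hA : A.PosSemidef) (hB : B.PosSemidef) :
    (1 + A * B).det ≤ (1 + A).det * (1 + B).det := by
  have hQ : (1 + B).PosDef := PosDef.one.add_posSemidef hB
  have hu : IsUnit (1 + B).det := hQ.det_pos.ne'.isUnit
  have first : (1 + A * B).det ≤ (1 + A * (1 + B)).det := by
    obtain ⟨S, rfl⟩ := hA.exists_eq_transpose_mul_self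
    have h1 : (S * B * S.transpose).PosSemidef := hB.mul_mul_conjTranspose_same S
    have h2 : (S * S.transpose).PosSemidef := posSemidef_self_mul_conjTranspose S
    have h := (PosDef.one.add_posSemidef h1).det_le_det_add h2
    rw [Matrix.mul_assoc, det_one_add_mul_comm, Matrix.mul_assoc S.transpose,
      det_one_add_mul_comm S.transpose]
    convert h using 2
    noncomm_ring
  have second : ((1 + B)⁻¹ + A).det ≤ (1 + A).det := by
    have hsq : (B + B * B).PosSemidef := by
      refine hB.add ?_
      have := posSemidef_self_mul_conjTranspose B
      rwa [hB.isHermitian.eq] at this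
    have h := hsq.mul_mul_conjTranspose_same (1 + B)⁻¹
    rw [hQ.inv.isHermitian.eq] at h
    have e : (1 + B)⁻¹ * (B + B * B) * (1 + B)⁻¹ = 1 - (1 + B)⁻¹ := by
      have : B + B * B = (1 + B) * (1 + B) - (1 + B) := by noncomm_ring
      rw [this, Matrix.mul_sub, ← Matrix.mul_assoc, nonsing_inv_mul _ hu, Matrix.one_mul,
        Matrix.sub_mul, mul_nonsing_inv _ hu, Matrix.one_mul]
    rw [e] at h
    convert (hQ.inv.add_posSemidef hA).det_le_det_add h using 2
    abel
  calc (1 + A * B).det ≤ (1 + A * (1 + B)).det := first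
    _ = ((1 + B)⁻¹ + A).det * (1 + B).det := by
      rw [← det_mul, Matrix.add_mul, nonsing_inv_mul _ hu]
    _ ≤ (1 + A).det * (1 + B).det := mul_le_mul_of_nonneg_right second hQ.det_pos.le

/-- For any two real n×n positive semidefinite matrices `A` and `B` and any real `P > 0`,
`det(I + A·B) ≤ det(I + P·A) · det(I + P⁻¹·B)`. -/
theorem stmt_5 {n : ℕ} (A B : Matrix (Fin n) (Fin n) ℝ)
    (hA : A.PosSemidef) (hB : B.PosSemidef) (P : ℝ) (hP : 0 < P) :
    (1 + A * B).det ≤ (1 + P • A).det * (1 + P⁻¹ • B).det := by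
  have h := (hA.smul hP.le).det_one_add_mul_le (hB.smul (inv_pos.mpr hP).le)
  rwa [Matrix.smul_mul, Matrix.mul_smul, smul_smul, mul_inv_cancel₀ hP.ne', one_smul] at h
end

section
/- Matrix determinant bound used in the constant-gap analysis of distributed decode–forward (Theorem 4). Let d, s be positive integers, G a real d×s matrix, P > 0, and K a real s×s positive semidefinite matrix with all diagonal entries K_{jj} ≤ P. Then both det(I_d + G·K·Gᵀ) ≤ 2^s · det(I_d + P·G·Gᵀ) and det(I_d + G·K·Gᵀ) ≤ s^d · det(I_d + P·G·Gᵀ) hold; consequently det(I_d + G·K·Gᵀ) ≤ min{2^s, s^d} · det(I_d + P·G·Gᵀ). -/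
namespace Matrix

variable {n : Type*} [Fintype n] [DecidableEq n] {A B : Matrix n n ℝ}

theorem PosSemidef.det_le_one_of_trace_le (hA : A.PosSemidef) (h : A.trace ≤ Fintype.card n) :
    A.det ≤ 1 := by
  have htr := hA.1.trace_eq_sum_eigenvalues
  rw [hA.1.det_eq_prod_eigenvalues]
  simp only [RCLike.ofReal_real_eq_id, id_eq] at htr ⊢
  calc ∏ i, hA.1.eigenvalues i
      ≤ ∏ i, Real.exp (hA.1.eigenvalues i - 1) :=
        Finset.prod_le_prod (fun i _ => hA.eigenvalues_nonneg i) fun i _ => by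
          linarith [Real.add_one_le_exp (hA.1.eigenvalues i - 1)]
    _ = Real.exp (A.trace - Fintype.card n) := by
        rw [← Real.exp_sum, Finset.sum_sub_distrib, ← htr]
        simp
    _ ≤ 1 := Real.exp_le_one_iff.mpr (by linarith)

open scoped MatrixOrder in
theorem PosSemidef.det_le_det_of_posDef (hA : A.PosSemidef) (hB : B.PosDef)
    (hAB : (B - A).PosSemidef) : A.det ≤ B.det := by
  obtain ⟨C, hC⟩ := CStarAlgebra.nonneg_iff_eq_star_mul_self.mp hB.posSemidef.nonneg
  rw [star_eq_conjTranspose] at hC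
  have hdet : B.det = C.det * C.det := by simp [hC]
  have hC0 : C.det ≠ 0 := fun h => hB.det_pos.ne' (by simp [hdet, h])
  have hunit : IsUnit C.det := hC0.isUnit
  have hone : C⁻¹ᴴ * B * C⁻¹ = 1 := by
    rw [hC, ← Matrix.mul_assoc, ← conjTranspose_mul, Matrix.mul_assoc, mul_nonsing_inv _ hunit]
    simp
  have htr := (hAB.conjTranspose_mul_mul_same C⁻¹).trace_nonneg
  rw [Matrix.mul_sub, Matrix.sub_mul, hone, trace_sub, trace_one] at htr
  have hle := (hA.conjTranspose_mul_mul_same C⁻¹).det_le_one_of_trace_le (by linarith)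
  simp only [det_mul, det_conjTranspose, star_trivial, det_nonsing_inv, Ring.inverse_eq_inv']
    at hle
  have hpos : 0 < C.det * C.det := hdet ▸ hB.det_pos
  calc A.det = (C.det⁻¹ * A.det * C.det⁻¹) * (C.det * C.det) := by field_simp
    _ ≤ 1 * (C.det * C.det) := by gcongr
    _ = B.det := by rw [one_mul, hdet]

theorem PosSemidef.posSemidef_trace_smul_one_sub (hA : A.PosSemidef) :
    (A.trace • (1 : Matrix n n ℝ) - A).PosSemidef := by
  rw [posSemidef_iff_isHermitian_and_spectrum_nonneg]
  refine ⟨(isHermitian_one.smul (IsSelfAdjoint.all _)).sub hA.1, ?_⟩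
  rw [← Algebra.algebraMap_eq_smul_one, ← spectrum.singleton_sub_eq,
    hA.1.spectrum_real_eq_range_eigenvalues]
  rintro _ ⟨_, rfl, _, ⟨i, rfl⟩, rfl⟩
  have htr := hA.1.trace_eq_sum_eigenvalues
  simp only [RCLike.ofReal_real_eq_id, id_eq] at htr
  have hi := Finset.single_le_sum (fun j _ => hA.eigenvalues_nonneg j) (Finset.mem_univ i)
  simpa [htr] using hi

variable {m : Type*} [Fintype m] [DecidableEq m]

omit [DecidableEq n] in
theorem PosSemidef.det_one_add_mul_mul_transpose_le (hA : A.PosSemidef)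
    (hAB : (B - A).PosSemidef) (G : Matrix m n ℝ) :
    (1 + G * A * Gᵀ).det ≤ (1 + G * B * Gᵀ).det := by
  have hB : B.PosSemidef := by simpa using hAB.add hA
  simp only [← conjTranspose_eq_transpose_of_trivial]
  refine (PosSemidef.one.add (hA.mul_mul_conjTranspose_same G)).det_le_det_of_posDef
    (PosDef.one.add_posSemidef (hB.mul_mul_conjTranspose_same G)) ?_
  rw [add_sub_add_left_eq_sub, ← Matrix.sub_mul, ← Matrix.mul_sub]
  exact hAB.mul_mul_conjTranspose_same G

theorem PosSemidef.posSemidef_inv_smul_one_sub_inv (hA : A.PosSemidef) {p : ℝ} (hp : 0 < p) :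
    (p⁻¹ • (1 : Matrix n n ℝ) - (A + p • 1)⁻¹).PosSemidef := by
  have hN : (A + p • (1 : Matrix n n ℝ)).PosDef := PosDef.posSemidef_add hA (PosDef.one.smul hp)
  set N := A + p • (1 : Matrix n n ℝ) with hNdef
  have hunit : IsUnit N.det := hN.det_pos.ne'.isUnit
  have hmid : (p⁻¹ • (N * N) - N).PosSemidef := by
    have : p⁻¹ • (N * N) - N = p⁻¹ • (Aᴴ * A) + A := by
      rw [hA.1, hNdef]
      simp only [Matrix.add_mul, Matrix.mul_add, Matrix.smul_mul, Matrix.mul_smul,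
        Matrix.mul_one, smul_add, smul_smul, inv_mul_cancel₀ hp.ne', one_smul, ← mul_assoc,
        one_mul]
      abel
    rw [this]
    exact ((posSemidef_conjTranspose_mul_self A).smul (inv_nonneg.mpr hp.le)).add hA
  have h := hmid.conjTranspose_mul_mul_same N⁻¹
  rw [hN.inv.1] at h
  convert h using 1
  rw [Matrix.mul_sub, Matrix.sub_mul, nonsing_inv_mul _ hunit, Matrix.one_mul, Matrix.mul_smul,
    nonsing_inv_mul_cancel_left _ _ hunit, Matrix.smul_mul, mul_nonsing_inv _ hunit]

theorem PosDef.det_one_add_mul_mul_transpose (hA : A.PosDef) (G : Matrix m n ℝ) :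
    (1 + G * A * Gᵀ).det = A.det * (A⁻¹ + Gᵀ * G).det := by
  rw [Matrix.mul_assoc, det_one_add_mul_comm, ← det_mul, Matrix.mul_add,
    mul_nonsing_inv _ hA.det_pos.ne'.isUnit, Matrix.mul_assoc]

/-- Adding `p • 1` to the covariance `A` costs at most the factor `det (p⁻¹ • (A + p • 1))`. -/
theorem PosSemidef.det_one_add_le_det_mul_det (hA : A.PosSemidef) {p : ℝ} (hp : 0 < p)
    (G : Matrix m n ℝ) :
    (1 + G * A * Gᵀ).det ≤ (p⁻¹ • (A + p • 1)).det * (1 + p • (G * Gᵀ)).det := by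
  have hpI : (p • (1 : Matrix n n ℝ)).PosDef := PosDef.one.smul hp
  have hN : (A + p • (1 : Matrix n n ℝ)).PosDef := PosDef.posSemidef_add hA hpI
  have hG : (Gᵀ * G).PosSemidef := by
    simpa using posSemidef_conjTranspose_mul_self G
  have hinv : (p • (1 : Matrix n n ℝ))⁻¹ = p⁻¹ • 1 := by
    rw [inv_eq_right_inv]
    simp [smul_smul, hp.ne']
  have hp1 := hpI.det_one_add_mul_mul_transpose G
  rw [Matrix.mul_smul, Matrix.mul_one, Matrix.smul_mul, hinv] at hp1
  calc (1 + G * A * Gᵀ).det ≤ (1 + G * (A + p • 1) * Gᵀ).det :=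
        hA.det_one_add_mul_mul_transpose_le (by simpa using hpI.posSemidef) G
    _ = (A + p • 1).det * ((A + p • 1)⁻¹ + Gᵀ * G).det := hN.det_one_add_mul_mul_transpose G
    _ ≤ (A + p • 1).det * (p⁻¹ • 1 + Gᵀ * G).det := by
        refine mul_le_mul_of_nonneg_left ?_ hN.det_pos.le
        refine (hN.inv.posSemidef.add hG).det_le_det_of_posDef
          ((PosDef.one.smul (inv_pos.mpr hp)).add_posSemidef hG) ?_
        rw [add_sub_add_right_eq_sub]
        exact hA.posSemidef_inv_smul_one_sub_inv hp
    _ = (p⁻¹ • (A + p • 1)).det * (1 + p • (G * Gᵀ)).det := by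
        rw [hp1]
        simp only [det_smul, det_one, mul_one]
        have : p ^ Fintype.card n ≠ 0 := pow_ne_zero _ hp.ne'
        rw [inv_pow]
        field_simp

theorem PosSemidef.det_one_add_le_two_pow_mul (hA : A.PosSemidef) {p : ℝ} (hp : 0 < p)
    (hdiag : ∀ i, A i i ≤ p) (G : Matrix m n ℝ) :
    (1 + G * A * Gᵀ).det ≤ 2 ^ Fintype.card n * (1 + p • (G * Gᵀ)).det := by
  have hG : (G * Gᵀ).PosSemidef := by
    simpa using posSemidef_self_mul_conjTranspose G
  refine (hA.det_one_add_le_det_mul_det hp G).trans ?_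
  refine mul_le_mul_of_nonneg_right ?_ (PosSemidef.one.add (hG.smul hp.le)).det_nonneg
  have hN : ((2 * p)⁻¹ • (A + p • (1 : Matrix n n ℝ))).PosSemidef :=
    (hA.add (PosSemidef.one.smul hp.le)).smul (by positivity)
  have htr : A.trace ≤ Fintype.card n * p := by
    simpa [trace] using Finset.sum_le_sum fun i (_ : i ∈ Finset.univ) => hdiag i
  have hdet := hN.det_le_one_of_trace_le (by
    rw [trace_smul, trace_add, trace_smul, trace_one, smul_eq_mul, smul_eq_mul,
      inv_mul_le_iff₀ (by positivity)]
    linarith)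
  have heq : p⁻¹ • (A + p • (1 : Matrix n n ℝ)) = (2 : ℝ) • (2 * p)⁻¹ • (A + p • 1) := by
    rw [smul_smul]
    congr 1
    field_simp
  rw [heq, det_smul]
  exact mul_le_of_le_one_right (by positivity) hdet

theorem PosSemidef.det_one_add_le_card_pow_mul [Nonempty n] (hA : A.PosSemidef) {p : ℝ}
    (hp : 0 < p) (hdiag : ∀ i, A i i ≤ p) (G : Matrix m n ℝ) :
    (1 + G * A * Gᵀ).det ≤ (Fintype.card n : ℝ) ^ Fintype.card m * (1 + p • (G * Gᵀ)).det := by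
  have hG : (G * Gᵀ).PosSemidef := by
    simpa using posSemidef_self_mul_conjTranspose G
  set k : ℝ := (Fintype.card n : ℝ)
  have hk : 1 ≤ k := Nat.one_le_cast.mpr Fintype.card_pos
  have htr : A.trace ≤ k * p := by
    simpa [trace] using Finset.sum_le_sum fun i (_ : i ∈ Finset.univ) => hdiag i
  have hsub : ((k * p) • (1 : Matrix n n ℝ) - A).PosSemidef := by
    have := (PosSemidef.one.smul (sub_nonneg.mpr htr)).add hA.posSemidef_trace_smul_one_sub
    convert this using 1
    rw [sub_smul]
    abel
  refine (hA.det_one_add_mul_mul_transpose_le hsub G).trans ?_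
  rw [← det_smul, Matrix.mul_smul, Matrix.mul_one, Matrix.smul_mul]
  have hS := hG.smul (mul_nonneg (zero_le_one.trans hk) hp.le)
  have hone : (1 + p • (G * Gᵀ)).PosDef := PosDef.one.add_posSemidef (hG.smul hp.le)
  refine (PosSemidef.one.add hS).det_le_det_of_posDef (hone.smul (by linarith)) ?_
  convert (PosSemidef.one (n := m) (R := ℝ)).smul (sub_nonneg.mpr hk) using 1
  rw [smul_add, smul_smul, sub_smul, one_smul]
  abel

end Matrix


/-- Matrix determinant bound used in the constant-gap analysis of distributed decode–forward.
Let `d, s` be positive integers, `G` a real d×s matrix, `P > 0`, and `K` a real s×s positive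
semidefinite matrix with all diagonal entries `K j j ≤ P`. Then
`det(I + G·K·Gᵀ) ≤ 2^s · det(I + P·G·Gᵀ)` and `det(I + G·K·Gᵀ) ≤ s^d · det(I + P·G·Gᵀ)`;
consequently `det(I + G·K·Gᵀ) ≤ min{2^s, s^d} · det(I + P·G·Gᵀ)`. -/
theorem stmt_9 {d s : ℕ} (hd : 0 < d) (hs : 0 < s)
    (G : Matrix (Fin d) (Fin s) ℝ) (P : ℝ) (hP : 0 < P)
    (K : Matrix (Fin s) (Fin s) ℝ) (hK : K.PosSemidef) (hdiag : ∀ j, K j j ≤ P) :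
    (1 + G * K * G.transpose).det ≤ (2 : ℝ) ^ s * (1 + P • (G * G.transpose)).det ∧
    (1 + G * K * G.transpose).det ≤ (s : ℝ) ^ d * (1 + P • (G * G.transpose)).det ∧
    (1 + G * K * G.transpose).det ≤
      min ((2 : ℝ) ^ s) ((s : ℝ) ^ d) * (1 + P • (G * G.transpose)).det := by
  have : Nonempty (Fin s) := ⟨⟨0, hs⟩⟩
  have h₁ := hK.det_one_add_le_two_pow_mul hP hdiag G
  have h₂ := hK.det_one_add_le_card_pow_mul hP hdiag G
  rw [Fintype.card_fin] at h₁
  rw [Fintype.card_fin, Fintype.card_fin] at h₂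
  refine ⟨h₁, h₂, ?_⟩
  rcases min_choice ((2 : ℝ) ^ s) ((s : ℝ) ^ d) with h | h <;> rw [h] <;> assumption
end

section
/- First entropy lemma from the Z-interference-channel impossibility argument (Example 2). Let U₀, U₁, U₂, V₀, V₁, X₁ be jointly distributed finite-valued random variables such that H(X₁ | U₀, U₁, U₂) = 0, H(X₁ | U₀, V₀, U₁, V₁) = 0, and I(U₀, U₁, U₂; V₀, V₁) = 0. Then H(X₁ | U₀, U₁) = 0. -/
open MeasureTheory

section SupportOfEntropy

variable {Ω α β : Type*}

lemma Real.sub_le_mul_log_sub_log {p q : ℝ} (hp : 0 < p) (hq : 0 < q) :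
    p - q ≤ p * (Real.log p - Real.log q) := by
  have h := Real.log_le_sub_one_of_pos (div_pos hq hp)
  rw [Real.log_div hq.ne' hp.ne'] at h
  have h' := mul_le_mul_of_nonneg_left h hp.le
  have e : p * (q / p - 1) = q - p := by field_simp
  linarith

lemma preimage_pair_singleton (X : Ω → α) (Y : Ω → β) (a : α) (b : β) :
    (fun ω => (X ω, Y ω)) ⁻¹' {(a, b)} = X ⁻¹' {a} ∩ Y ⁻¹' {b} := by
  ext ω
  simp

variable [MeasurableSpace Ω] {μ : Measure Ω}

lemma entH_pair_eq [Fintype α] [Fintype β] (X : Ω → α) (Y : Ω → β) :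
    entH μ (fun ω => (X ω, Y ω)) = -∑ a, ∑ b, μ.real (X ⁻¹' {a} ∩ Y ⁻¹' {b}) *
      Real.logb 2 (μ.real (X ⁻¹' {a} ∩ Y ⁻¹' {b})) := by
  simp only [entH, Fintype.sum_prod_type, preimage_pair_singleton, measureReal_def]

lemma ae_measureReal_fiber_pos [IsFiniteMeasure μ] [Finite β] (Y : Ω → β) :
    ∀ᵐ ω ∂μ, 0 < μ.real (Y ⁻¹' {Y ω}) := by
  have h : ∀ b, ∀ᵐ ω ∂μ, Y ω = b → 0 < μ.real (Y ⁻¹' {b}) := by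
    intro b
    by_cases hb : μ (Y ⁻¹' {b}) = 0
    · filter_upwards [measure_eq_zero_iff_ae_notMem.1 hb] with ω hω h
      exact absurd h hω
    · exact ae_of_all _ fun _ _ => ENNReal.toReal_pos hb (measure_ne_top _ _)
  filter_upwards [ae_all_iff.2 h] with ω hω using hω _ rfl

lemma sum_measureReal_inter_preimage_singleton [IsFiniteMeasure μ] [Fintype α]
    [MeasurableSpace α] [MeasurableSingletonClass α] {X : Ω → α} (hX : Measurable X) (s : Set Ω) :
    ∑ a, μ.real (s ∩ X ⁻¹' {a}) = μ.real s := by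
  classical
  have h := sum_measureReal_preimage_singleton (μ := μ.restrict s) (f := X) Finset.univ
    (fun a _ => hX (measurableSet_singleton a))
  simp only [Finset.coe_univ, Set.preimage_univ, measureReal_restrict_apply_univ] at h
  rw [← h]
  refine Finset.sum_congr rfl fun a _ => ?_
  rw [measureReal_restrict_apply (hX (measurableSet_singleton a)), Set.inter_comm]

lemma entH_fst_eq [IsFiniteMeasure μ] [Fintype α] [Fintype β]
    [MeasurableSpace β] [MeasurableSingletonClass β] {Y : Ω → β} (X : Ω → α) (hY : Measurable Y) :
    entH μ X = -∑ a, ∑ b, μ.real (X ⁻¹' {a} ∩ Y ⁻¹' {b}) * Real.logb 2 (μ.real (X ⁻¹' {a})) := by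
  simp only [← Finset.sum_mul, sum_measureReal_inter_preimage_singleton hY]
  rfl

lemma entH_snd_eq [IsFiniteMeasure μ] [Fintype α] [Fintype β]
    [MeasurableSpace α] [MeasurableSingletonClass α] {X : Ω → α} (hX : Measurable X) (Y : Ω → β) :
    entH μ Y = -∑ a, ∑ b, μ.real (X ⁻¹' {a} ∩ Y ⁻¹' {b}) * Real.logb 2 (μ.real (Y ⁻¹' {b})) := by
  rw [Finset.sum_comm]
  simp only [← Finset.sum_mul, Set.inter_comm (X ⁻¹' _), sum_measureReal_inter_preimage_singleton hX]
  rfl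

variable [Fintype α] [Fintype β] [MeasurableSpace α] [MeasurableSingletonClass α]
  {X : Ω → α} {Y : Ω → β}

lemma condEntH_eq_sum [IsFiniteMeasure μ] (hX : Measurable X) (Y : Ω → β) :
    condEntH μ X Y = ∑ a, ∑ b, μ.real (X ⁻¹' {a} ∩ Y ⁻¹' {b}) *
      (Real.logb 2 (μ.real (Y ⁻¹' {b})) - Real.logb 2 (μ.real (X ⁻¹' {a} ∩ Y ⁻¹' {b}))) := by
  rw [condEntH, entH_pair_eq, entH_snd_eq hX Y]
  simp only [mul_sub, Finset.sum_sub_distrib]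
  ring

/-- A vanishing conditional entropy forces every joint atom to fill its whole fiber. -/
lemma measureReal_inter_eq_of_condEntH_eq_zero [IsFiniteMeasure μ] (hX : Measurable X)
    (h : condEntH μ X Y = 0) {a : α} {b : β} (hab : 0 < μ.real (X ⁻¹' {a} ∩ Y ⁻¹' {b})) :
    μ.real (X ⁻¹' {a} ∩ Y ⁻¹' {b}) = μ.real (Y ⁻¹' {b}) := by
  have hnonneg : ∀ a b, 0 ≤ μ.real (X ⁻¹' {a} ∩ Y ⁻¹' {b}) *
      (Real.logb 2 (μ.real (Y ⁻¹' {b})) - Real.logb 2 (μ.real (X ⁻¹' {a} ∩ Y ⁻¹' {b}))) := by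
    intro a b
    rcases (measureReal_nonneg (μ := μ) (s := X ⁻¹' {a} ∩ Y ⁻¹' {b})).eq_or_lt with h0 | h0
    · simp [← h0]
    · exact mul_nonneg h0.le (sub_nonneg.2 (Real.logb_le_logb_of_le one_lt_two h0
        (measureReal_mono Set.inter_subset_right)))
  rw [condEntH_eq_sum hX, Finset.sum_eq_zero_iff_of_nonneg
    fun a _ => Finset.sum_nonneg fun b _ => hnonneg a b] at h
  have h' := (Finset.sum_eq_zero_iff_of_nonneg fun b _ => hnonneg a b).1 (h a (Finset.mem_univ a))
    b (Finset.mem_univ b)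
  have hlog := (mul_eq_zero.1 h').resolve_left hab.ne'
  exact Real.logb_injOn_pos one_lt_two hab
    (hab.trans_le (measureReal_mono Set.inter_subset_right)) (sub_eq_zero.1 hlog).symm

/-- `H(X | Y) = 0` iff `X` is almost surely a function of `Y`. -/
lemma condEntH_eq_zero_iff [IsProbabilityMeasure μ] (hX : Measurable X) :
    condEntH μ X Y = 0 ↔ ∃ f : β → α, ∀ᵐ ω ∂μ, X ω = f (Y ω) := by
  classical
  constructor
  · intro h
    have : Nonempty α := (nonempty_of_isProbabilityMeasure μ).map X
    have hf : ∀ b, ∃ a, ∀ a', 0 < μ.real (X ⁻¹' {a'} ∩ Y ⁻¹' {b}) → a' = a := by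
      intro b
      by_cases hb : ∃ a, 0 < μ.real (X ⁻¹' {a} ∩ Y ⁻¹' {b})
      · obtain ⟨a, ha⟩ := hb
        refine ⟨a, fun a' ha' => ?_⟩
        by_contra hne
        have hsum := sum_measureReal_inter_preimage_singleton (μ := μ) hX (Y ⁻¹' {b})
        simp only [Set.inter_comm (Y ⁻¹' {b})] at hsum
        have hle := Finset.add_le_sum (s := Finset.univ)
          (f := fun a => μ.real (X ⁻¹' {a} ∩ Y ⁻¹' {b})) (fun _ _ => measureReal_nonneg)
          (Finset.mem_univ a') (Finset.mem_univ a) hne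
        rw [hsum] at hle
        have e := measureReal_inter_eq_of_condEntH_eq_zero hX h ha
        linarith
      · push Not at hb
        exact ⟨Classical.arbitrary α, fun a' ha' => absurd ha' (hb a').not_gt⟩
    choose f hf using hf
    refine ⟨f, ?_⟩
    filter_upwards [ae_measureReal_fiber_pos (μ := μ) fun ω => (X ω, Y ω)] with ω hω
    rw [preimage_pair_singleton] at hω
    exact hf _ _ hω
  · rintro ⟨f, hf⟩
    rw [condEntH_eq_sum hX]
    refine Finset.sum_eq_zero fun a _ => Finset.sum_eq_zero fun b _ => ?_
    by_cases hab : a = f b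
    · have : μ.real (X ⁻¹' {a} ∩ Y ⁻¹' {b}) = μ.real (Y ⁻¹' {b}) := by
        refine measureReal_congr ?_
        filter_upwards [hf] with ω hω
        refine propext ⟨fun h => h.2, fun h => ⟨?_, h⟩⟩
        have hb : Y ω = b := h
        change X ω = a
        rw [hω, hb, hab]
      rw [this, sub_self, mul_zero]
    · have : μ (X ⁻¹' {a} ∩ Y ⁻¹' {b}) = 0 := by
        refine measure_eq_zero_iff_ae_notMem.2 ?_
        filter_upwards [hf] with ω hω
        rintro ⟨ha, hb⟩
        have ha : X ω = a := ha
        have hb : Y ω = b := hb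
        exact hab (by rw [← ha, hω, hb])
      rw [measureReal_def, this, ENNReal.toReal_zero, zero_mul]

lemma measureReal_inter_pos_of_miH_eq_zero [IsProbabilityMeasure μ] [MeasurableSpace β]
    [MeasurableSingletonClass β] (hX : Measurable X) (hY : Measurable Y)
    (h : miH μ X Y = 0) {a : α} {b : β} (ha : 0 < μ.real (X ⁻¹' {a}))
    (hb : 0 < μ.real (Y ⁻¹' {b})) : 0 < μ.real (X ⁻¹' {a} ∩ Y ⁻¹' {b}) := by
  let p : α → β → ℝ := fun a b => μ.real (X ⁻¹' {a} ∩ Y ⁻¹' {b})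
  let q : α → β → ℝ := fun a b => μ.real (X ⁻¹' {a}) * μ.real (Y ⁻¹' {b})
  let t : α → β → ℝ := fun a b => p a b * (Real.log (p a b) -
    (Real.log (μ.real (X ⁻¹' {a})) + Real.log (μ.real (Y ⁻¹' {b})))) - p a b + q a b
  have ht : ∀ a b, 0 ≤ t a b := by
    intro a b
    rcases (measureReal_nonneg (μ := μ) (s := X ⁻¹' {a} ∩ Y ⁻¹' {b})).eq_or_lt with h0 | h0
    · have : 0 ≤ q a b := by positivity
      simpa [t, p, ← h0] using this
    · have hx : 0 < μ.real (X ⁻¹' {a}) := h0.trans_le (measureReal_mono Set.inter_subset_left)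
      have hy : 0 < μ.real (Y ⁻¹' {b}) := h0.trans_le (measureReal_mono Set.inter_subset_right)
      have := Real.sub_le_mul_log_sub_log h0 (mul_pos hx hy)
      rw [Real.log_mul hx.ne' hy.ne'] at this
      simp only [t, p, q]
      linarith
  have hp1 : ∑ a, ∑ b, p a b = 1 := by
    simp only [p, sum_measureReal_inter_preimage_singleton hY]
    simpa using sum_measureReal_inter_preimage_singleton (μ := μ) hX Set.univ
  have hq1 : ∑ a, ∑ b, q a b = 1 := by
    have h1 := sum_measureReal_inter_preimage_singleton (μ := μ) hX Set.univ
    have h2 := sum_measureReal_inter_preimage_singleton (μ := μ) hY Set.univ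
    simp only [Set.univ_inter, probReal_univ] at h1 h2
    simp only [q, ← Finset.mul_sum, h2, mul_one, h1]
  have hsum : ∑ a, ∑ b, t a b = 0 := by
    rw [miH, entH_fst_eq X hY, entH_snd_eq hX Y, entH_pair_eq] at h
    simp only [Real.logb, mul_div_assoc', ← Finset.sum_div] at h
    have hlog : Real.log 2 ≠ 0 := (Real.log_pos one_lt_two).ne'
    field_simp at h
    simp only [t, mul_sub, mul_add, Finset.sum_add_distrib, Finset.sum_sub_distrib, hp1, hq1]
    simp only [p]
    linarith
  rw [Finset.sum_eq_zero_iff_of_nonneg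
    fun a _ => Finset.sum_nonneg fun b _ => ht a b] at hsum
  have h0 := (Finset.sum_eq_zero_iff_of_nonneg fun b _ => ht a b).1 (hsum a (Finset.mem_univ a))
    b (Finset.mem_univ b)
  refine measureReal_nonneg.lt_of_ne fun hp => (mul_pos ha hb).ne' ?_
  simpa [t, p, q, ← hp] using h0

end SupportOfEntropy

/-- First entropy lemma from the Z-interference-channel impossibility argument:
if `H(X₁ | U₀,U₁,U₂) = 0`, `H(X₁ | U₀,V₀,U₁,V₁) = 0` and `I(U₀,U₁,U₂; V₀,V₁) = 0`,
then `H(X₁ | U₀,U₁) = 0`. -/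
theorem stmt_10 {Ω : Type*} [MeasurableSpace Ω] (μ : Measure Ω) [IsProbabilityMeasure μ]
    {A0 A1 A2 B0 B1 G : Type*}
    [Fintype A0] [Fintype A1] [Fintype A2] [Fintype B0] [Fintype B1] [Fintype G]
    [MeasurableSpace A0] [MeasurableSingletonClass A0]
    [MeasurableSpace A1] [MeasurableSingletonClass A1]
    [MeasurableSpace A2] [MeasurableSingletonClass A2]
    [MeasurableSpace B0] [MeasurableSingletonClass B0]
    [MeasurableSpace B1] [MeasurableSingletonClass B1]
    [MeasurableSpace G] [MeasurableSingletonClass G]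
    (U0 : Ω → A0) (U1 : Ω → A1) (U2 : Ω → A2) (V0 : Ω → B0) (V1 : Ω → B1) (X1 : Ω → G)
    (hU0 : Measurable U0) (hU1 : Measurable U1) (hU2 : Measurable U2)
    (hV0 : Measurable V0) (hV1 : Measurable V1) (hX1 : Measurable X1)
    (h1 : condEntH μ X1 (fun ω => (U0 ω, U1 ω, U2 ω)) = 0)
    (h2 : condEntH μ X1 (fun ω => (U0 ω, V0 ω, U1 ω, V1 ω)) = 0)
    (h3 : miH μ (fun ω => (U0 ω, U1 ω, U2 ω)) (fun ω => (V0 ω, V1 ω)) = 0) :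
    condEntH μ X1 (fun ω => (U0 ω, U1 ω)) = 0 := by
  obtain ⟨f, hf⟩ := (condEntH_eq_zero_iff hX1).1 h1
  obtain ⟨g, hg⟩ := (condEntH_eq_zero_iff hX1).1 h2
  obtain ⟨ω₀, hω₀⟩ := (ae_measureReal_fiber_pos (μ := μ) fun ω => (V0 ω, V1 ω)).exists
  refine (condEntH_eq_zero_iff hX1).2
    ⟨fun u => g (u.1, V0 ω₀, u.2, V1 ω₀), ?_⟩
  filter_upwards [hf, ae_measureReal_fiber_pos (μ := μ) fun ω => (U0 ω, U1 ω, U2 ω)] with ω hω hpos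
  have hpair := measureReal_inter_pos_of_miH_eq_zero (hU0.prodMk (hU1.prodMk hU2))
    (hV0.prodMk hV1) h3 hpos hω₀
  have hfreq : ∃ᵐ ω' ∂μ, (U0 ω', U1 ω', U2 ω') = (U0 ω, U1 ω, U2 ω) ∧
      (V0 ω', V1 ω') = (V0 ω₀, V1 ω₀) := by
    refine frequently_ae_iff.2 fun hzero => hpair.ne' ?_
    exact (measureReal_eq_zero_iff).2 hzero
  obtain ⟨ω', ⟨hU, hV⟩, hf', hg'⟩ := (hfreq.and_eventually (hf.and hg)).exists
  simp only [Prod.mk.injEq] at hU hV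
  rw [hω, ← hU.1, ← hU.2.1, ← hU.2.2, ← hV.1, ← hV.2, ← hf', hg']
end
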